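/- arXiv:1808.04652 — 3 statements merged into one kernel-verified Lean document; each statement's English description precedes it below -/
import Mathlib

section
/- Let $(A,\mathfrak{m},k)$ be a commutative Noetherian local ring, $\mathfrak{a}$ an ideal, and $M$ an $A$-module such that $\operatorname{D}(\operatorname{H}^i_{\mathfrak{a}}(M)) = \mathfrak{a} \cdot \operatorname{D}(\operatorname{H}^i_{\mathfrak{a}}(M))$. Then $\operatorname{D}(\operatorname{H}^i_{\mathfrak{a}}(M)) = 0$. -/
open CategoryTheory Opposite IsLocalRing

universe u

def IsInjectiveHullOfResidueField (R : Type u) [CommRing R] [IsLocalRing R]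
    (E : Type u) [AddCommGroup E] [Module R E] : Prop :=
  Module.Injective R E ∧
    ∃ ι : ResidueField R →ₗ[R] E, Function.Injective ι ∧
      ∀ N : Submodule R E, N ≠ ⊥ → N ⊓ LinearMap.range ι ≠ ⊥

namespace CategoryTheory.ProjectiveResolution

variable {R : Type*} [CommRing R] {C : Type*} [Category* C] [Abelian C] [Linear R C]

/-- If `a` kills `X`, then multiplication by `a` on a projective resolution of `X` is
null-homotopic. -/
noncomputable def smulIdHomotopyZero {X : C} (P : ProjectiveResolution X) {a : R}
    (ha : a • 𝟙 X = 0) : Homotopy (a • 𝟙 P.complex) 0 :=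
  liftHomotopyZero _ <| by
    have h : a • P.π.f 0 = 0 := by
      have hX : P.π.f 0 ≫ (a • 𝟙 X) = P.π.f 0 ≫ (0 : X ⟶ X) := congrArg (P.π.f 0 ≫ ·) ha
      exact (congrArg (a • ·) (Category.comp_id _)).symm.trans
        ((Linear.comp_smul ..).symm.trans (hX.trans Limits.comp_zero))
    ext
    simpa using h

/-- If `a` kills `X`, then multiplication by `a` on the complex computing `Ext(X, Y)` is
null-homotopic. -/
noncomputable def linearYonedaObjSMulIdHomotopyZero {X : C} (P : ProjectiveResolution X) {a : R}
    (ha : a • 𝟙 X = 0) (Y : C) :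
    Homotopy (a • 𝟙 (P.complex.linearYonedaObj R Y)) 0 :=
  (Homotopy.ofEq (by
    ext n x
    exact ((Linear.smul_comp _ _ _ a (𝟙 (P.complex.X n)) x).trans
      (congrArg (a • ·) (Category.id_comp _))).symm)).trans
  ((((linearYoneda R C).obj Y).rightOp.mapHomotopy (P.smulIdHomotopyZero ha)).unop.trans
    (Homotopy.ofEq (by
      ext n x
      exact Limits.zero_comp (f := x))))

end CategoryTheory.ProjectiveResolution

/-- An element of the base ring that kills `X` also kills `Ext(X, Y)`. -/
theorem Ext_smul_id_eq_zero {R : Type*} [CommRing R] {C : Type*} [Category* C] [Abelian C]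
    [Linear R C] [EnoughProjectives C] {X : C} {a : R} (ha : a • 𝟙 X = 0) (n : ℕ) (Y : C) :
    a • 𝟙 (((Ext R C n).obj (op X)).obj Y) = 0 := by
  let P := projectiveResolution X
  have h : a • 𝟙 ((P.complex.linearYonedaObj R Y).homology n) = 0 := by
    have := (P.linearYonedaObjSMulIdHomotopyZero ha Y).homologyMap_eq n
    rw [HomologicalComplex.homologyMap_zero] at this
    rw [← HomologicalComplex.homologyMap_id, ← this]
    exact (ShortComplex.homologyMap_smul ..).symm
  let e := P.isoExt (R := R) n Y
  rw [← cancel_mono e.hom, Linear.smul_comp, Category.id_comp, ← Category.comp_id e.hom,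
    ← Linear.comp_smul, h, Limits.comp_zero, Limits.zero_comp]

theorem LinearMap.comp_eq_zero_of_mem_smul_top {R M N P : Type*} [CommRing R] [AddCommGroup M]
    [Module R M] [AddCommGroup N] [Module R N] [AddCommGroup P] [Module R P] {I : Ideal R}
    {g : N →ₗ[R] P} (hg : g ∈ I • (⊤ : Submodule R (N →ₗ[R] P))) (f : M →ₗ[R] N)
    (hf : ∀ a ∈ I, a • f = 0) : g ∘ₗ f = 0 := by
  have : I • (⊤ : Submodule R (N →ₗ[R] P)) ≤ LinearMap.ker (LinearMap.lcomp R P f) := by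
    refine Submodule.smul_le.2 fun a ha g _ => ?_
    change (a • g) ∘ₗ f = 0
    rw [LinearMap.smul_comp, ← LinearMap.comp_smul, hf a ha, LinearMap.comp_zero]
  exact this hg

/-- A linear map out of the local cohomology `H^i_𝔞(M)` vanishes if it vanishes on the image of
each `Ext^i(A / 𝔞 ^ n, M)`. -/
theorem localCohomology.hom_ext_zero {A : Type u} [CommRing A] (𝔞 : Ideal A) (i : ℕ)
    (M N : ModuleCat.{u} A) (f : (localCohomology 𝔞 i).obj M ⟶ N)
    (hf : ∀ t : ℕᵒᵖᵒᵖ,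
      (Limits.colimit.ι (diagram (idealPowersDiagram 𝔞) i) t).app M ≫ f = 0) :
    f = 0 := by
  refine (Limits.isColimitOfPreserves ((evaluation _ _).obj M)
    (Limits.colimit.isColimit (diagram (idealPowersDiagram 𝔞) i))).hom_ext fun t => ?_
  exact (hf t).trans Limits.comp_zero.symm

/-- If the Matlis dual of a local cohomology module satisfies `D = 𝔞 • D`, then `D = 0`. -/
theorem matlisDual_eq_smul_eq_zero
    (A : Type u) [CommRing A] [IsLocalRing A] [IsNoetherianRing A]
    (E : Type u) [AddCommGroup E] [Module A E]
    (hE : IsInjectiveHullOfResidueField A E)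
    (𝔞 : Ideal A) (i : ℕ) (M : ModuleCat.{u} A)
    (h : 𝔞 • (⊤ : Submodule A (((localCohomology 𝔞 i).obj M) →ₗ[A] E)) = ⊤) :
    Subsingleton (((localCohomology 𝔞 i).obj M) →ₗ[A] E) := by
  have hpow (n : ℕ) : 𝔞 ^ n • (⊤ : Submodule A (((localCohomology 𝔞 i).obj M) →ₗ[A] E)) = ⊤ := by
    induction n with
    | zero => simp
    | succ n ih => rw [pow_succ, Submodule.mul_smul, h, ih]
  refine subsingleton_of_forall_eq 0 fun g => ?_
  suffices ModuleCat.ofHom g = 0 from congrArg ModuleCat.Hom.hom this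
  refine localCohomology.hom_ext_zero 𝔞 i M (ModuleCat.of A E) _ fun t => ?_
  ext1
  refine LinearMap.comp_eq_zero_of_mem_smul_top (I := 𝔞 ^ t.unop.unop)
    ((hpow _).ge trivial) _
    fun a ha => ?_
  have ha' : a • 𝟙 ((localCohomology.ringModIdeals (localCohomology.idealPowersDiagram 𝔞)).obj
      t.unop) = 0 := by
    ext x
    obtain ⟨x, rfl⟩ := Ideal.Quotient.mk_surjective x
    exact Ideal.Quotient.eq_zero_iff_mem.2 (Ideal.mul_mem_right x _ ha)
  have hext := congrArg (· ≫ (Limits.colimit.ι (localCohomology.diagram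
    (localCohomology.idealPowersDiagram 𝔞) i) t).app M) (Ext_smul_id_eq_zero ha' i M)
  exact congrArg ModuleCat.Hom.hom
    (((Linear.smul_comp ..).trans (congrArg (a • ·) (Category.id_comp _))).symm.trans
      (hext.trans Limits.zero_comp))
end

section
/- Let $A$ be a commutative Noetherian ring, $\mathfrak{a}$ an ideal, and $M$ any $A$-module (not necessarily finitely generated). Let $c = \operatorname{cd}(\mathfrak{a}, M)$ be the cohomological dimension, i.e., the supremum of the integers $i$ with $\operatorname{H}^i_{\mathfrak{a}}(M) \neq 0$. If $c > 0$, then $\operatorname{H}^c_{\mathfrak{a}}(M)$ is not finitely generated. -/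
open CategoryTheory

universe u

noncomputable section

open Abelian

namespace TopLocalCohomology

section Ext

variable {A : Type u} [CommRing A] (M : ModuleCat.{u} A)
variable {X Y Z : Type u} [AddCommGroup X] [Module A X] [AddCommGroup Y] [Module A Y]
  [AddCommGroup Z] [Module A Z]

/-- The contravariant functoriality of `Ext^i(-, M)` along a linear map. -/
def pull (i : ℕ) (f : X →ₗ[A] Y) :
    Ext (ModuleCat.of A Y) M i →ₗ[A] Ext (ModuleCat.of A X) M i :=
  (Ext.mk₀ (ModuleCat.ofHom f)).precompOfLinear A M (zero_add i)

lemma pull_apply (i : ℕ) (f : X →ₗ[A] Y) (ξ : Ext (ModuleCat.of A Y) M i) :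
    pull M i f ξ = (Ext.mk₀ (ModuleCat.ofHom f)).comp ξ (zero_add i) := rfl

lemma pull_pull (i : ℕ) (f : X →ₗ[A] Y) (g : Y →ₗ[A] Z) (ξ : Ext (ModuleCat.of A Z) M i) :
    pull M i f (pull M i g ξ) = pull M i (g ∘ₗ f) ξ := by
  simp [pull_apply, ModuleCat.ofHom_comp]

lemma pull_id (i : ℕ) (ξ : Ext (ModuleCat.of A X) M i) :
    pull M i (LinearMap.id : X →ₗ[A] X) ξ = ξ := by
  simp [pull_apply]

lemma pull_smul (i : ℕ) (a : A) (f : X →ₗ[A] Y) (ξ : Ext (ModuleCat.of A Y) M i) :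
    pull M i (a • f) ξ = a • pull M i f ξ := by
  have : ModuleCat.ofHom (a • f) = a • ModuleCat.ofHom f := rfl
  simp [pull_apply, this, Ext.mk₀_smul]

lemma pull_zero (i : ℕ) (ξ : Ext (ModuleCat.of A Y) M i) :
    pull M i (0 : X →ₗ[A] Y) ξ = 0 := by
  have : ModuleCat.ofHom (0 : X →ₗ[A] Y) = 0 := rfl
  simp [pull_apply, this]

lemma pull_sum {ι : Type*} [Fintype ι] (i : ℕ) (f : ι → X →ₗ[A] Y)
    (ξ : Ext (ModuleCat.of A Y) M i) :
    pull M i (∑ j, f j) ξ = ∑ j, pull M i (f j) ξ := by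
  have : ModuleCat.ofHom (∑ j, f j) = ∑ j, ModuleCat.ofHom (f j) := by
    ext x
    simp
  simp [pull_apply, this, Ext.mk₀_sum, Ext.sum_comp]

lemma shortExact {f : X →ₗ[A] Y} {g : Y →ₗ[A] Z} (hf : Function.Injective f)
    (hg : Function.Surjective g) (h : Function.Exact f g) :
    (ShortComplex.mk (ModuleCat.ofHom f) (ModuleCat.ofHom g)
      (by rw [← ModuleCat.ofHom_comp, h.linearMap_comp_eq_zero]; rfl)).ShortExact where
  exact := by
    rw [ShortComplex.ShortExact.moduleCat_exact_iff_function_exact]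
    exact h
  mono_f := (ModuleCat.mono_iff_injective _).2 hf
  epi_g := (ModuleCat.epi_iff_surjective _).2 hg

/-- The connecting map of the contravariant long exact sequence of `Ext^•(-, M)`. -/
def delta {f : X →ₗ[A] Y} {g : Y →ₗ[A] Z} (hf : Function.Injective f)
    (hg : Function.Surjective g) (h : Function.Exact f g) (i : ℕ) :
    Ext (ModuleCat.of A X) M i →ₗ[A] Ext (ModuleCat.of A Z) M (i + 1) :=
  (shortExact hf hg h).extClass.precompOfLinear A M (add_comm 1 i)

variable {M}
variable {f : X →ₗ[A] Y} {g : Y →ₗ[A] Z} (hf : Function.Injective f)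
    (hg : Function.Surjective g) (h : Function.Exact f g) {i : ℕ}

lemma exists_pull_of_delta_eq_zero {ξ : Ext (ModuleCat.of A X) M i}
    (hξ : delta M hf hg h i ξ = 0) : ∃ θ, pull M i f θ = ξ :=
  Ext.contravariant_sequence_exact₁ (shortExact hf hg h) M ξ (add_comm 1 i) hξ

lemma exists_delta_of_pull_eq_zero {ζ : Ext (ModuleCat.of A Z) M (i + 1)}
    (hζ : pull M (i + 1) g ζ = 0) : ∃ ξ, delta M hf hg h i ξ = ζ :=
  Ext.contravariant_sequence_exact₃ (shortExact hf hg h) M ζ hζ (add_comm 1 i)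

lemma delta_naturality {X' Y' Z' : Type u} [AddCommGroup X'] [Module A X'] [AddCommGroup Y']
    [Module A Y'] [AddCommGroup Z'] [Module A Z'] {f' : X' →ₗ[A] Y'} {g' : Y' →ₗ[A] Z'}
    (hf' : Function.Injective f') (hg' : Function.Surjective g') (h' : Function.Exact f' g')
    (α : X →ₗ[A] X') (β : Y →ₗ[A] Y') (γ : Z →ₗ[A] Z') (hα : f' ∘ₗ α = β ∘ₗ f)
    (hγ : g' ∘ₗ β = γ ∘ₗ g) (ξ : Ext (ModuleCat.of A X') M i) :
    delta M hf hg h i (pull M i α ξ) = pull M (i + 1) γ (delta M hf' hg' h' i ξ) := by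
  let φ : ShortComplex.mk (ModuleCat.ofHom f) (ModuleCat.ofHom g)
      (by rw [← ModuleCat.ofHom_comp, h.linearMap_comp_eq_zero]; rfl) ⟶
      ShortComplex.mk (ModuleCat.ofHom f') (ModuleCat.ofHom g')
      (by rw [← ModuleCat.ofHom_comp, h'.linearMap_comp_eq_zero]; rfl) :=
    { τ₁ := ModuleCat.ofHom α
      τ₂ := ModuleCat.ofHom β
      τ₃ := ModuleCat.ofHom γ
      comm₁₂ := by simp only [← ModuleCat.ofHom_comp, hα]
      comm₂₃ := by simp only [← ModuleCat.ofHom_comp, hγ] }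
  have key := (shortExact hf hg h).extClass_naturality (shortExact hf' hg' h') φ
  have e1 : delta M hf hg h i (pull M i α ξ) =
      ((shortExact hf hg h).extClass.comp (Ext.mk₀ φ.τ₁) (add_zero 1)).comp ξ (add_comm 1 i) :=
    (Ext.comp_assoc_of_second_deg_zero _ _ _ _).symm
  have e2 : pull M (i + 1) γ (delta M hf' hg' h' i ξ) =
      ((Ext.mk₀ φ.τ₃).comp (shortExact hf' hg' h').extClass (zero_add 1)).comp ξ
        (add_comm 1 i) :=
    (Ext.comp_assoc _ _ _ _ (add_comm 1 i) (by lia)).symm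
  rw [e1, e2, key]

end Ext

section Restriction

variable {A : Type u} [CommRing A] {M : ModuleCat.{u} A}
variable {L : Type u} [AddCommGroup L] [Module A L] {i : ℕ}

variable (M) in
/-- Restriction of `Ext^i(-, M)` from a submodule to a smaller one. -/
abbrev res (i : ℕ) {N' N : Submodule A L} (h : N' ≤ N) :
    Ext (ModuleCat.of A N) M i →ₗ[A] Ext (ModuleCat.of A N') M i :=
  pull M i (Submodule.inclusion h)

lemma res_res {N₁ N₂ N₃ : Submodule A L} (h : N₁ ≤ N₂) (h' : N₂ ≤ N₃)
    (ξ : Ext (ModuleCat.of A N₃) M i) : res M i h (res M i h' ξ) = res M i (h.trans h') ξ :=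
  pull_pull ..

/-- For a submodule `N` of a module `L`, every class in `Ext^i(N', M)`, where `N'` is open in the
`𝔞`-adic topology of `N`, dies on a smaller open submodule. Over a Noetherian ring, this is the
vanishing of `Ext^i` from `N` to `M` on the complement of `V(𝔞)`. -/
def Effaceable (𝔞 : Ideal A) (M : ModuleCat.{u} A) (i : ℕ) (N : Submodule A L) : Prop :=
  ∀ N' ≤ N, ∀ t : ℕ, 𝔞 ^ t • N ≤ N' → ∀ ξ : Ext (ModuleCat.of A N') M i,
    ∃ (s : ℕ) (h : 𝔞 ^ s • N ≤ N'), res M i h ξ = 0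

variable {𝔞 : Ideal A}

lemma pow_smul_anti {s t : ℕ} (h : s ≤ t) (N : Submodule A L) : 𝔞 ^ t • N ≤ 𝔞 ^ s • N :=
  Submodule.smul_mono_left (Ideal.pow_le_pow_right h)

lemma Effaceable.bot : Effaceable 𝔞 M i (⊥ : Submodule A L) := by
  intro N' hN' t ht ξ
  refine ⟨t, ht, ?_⟩
  have : Submodule.inclusion ht = 0 := by
    ext x
    have := hN' (ht x.2)
    simpa using this
  rw [res, this, pull_zero]

lemma Effaceable.mono {B Z : Submodule A L} (h : Effaceable 𝔞 M i Z) (hBZ : B ≤ Z)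
    {r : ℕ} (hr : 𝔞 ^ r • Z ≤ B) : Effaceable 𝔞 M i B := by
  intro N' hN' t ht ξ
  have h1 : 𝔞 ^ (t + r) • Z ≤ N' := by
    rw [pow_add, mul_smul]
    exact (Submodule.smul_mono le_rfl hr).trans ht
  obtain ⟨s, hs, hs0⟩ := h N' (hN'.trans hBZ) (t + r) h1 ξ
  have h2 : 𝔞 ^ s • B ≤ 𝔞 ^ s • Z := Submodule.smul_mono le_rfl hBZ
  exact ⟨s, h2.trans hs, by rw [← res_res h2 hs, hs0, map_zero]⟩

/-- The Artin-Rees lemma, in the form of a comparison of topologies. -/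
lemma exists_pow_smul_inf_le [IsNoetherianRing A] [Module.Finite A L] (N Z : Submodule A L)
    (t : ℕ) : ∃ r, 𝔞 ^ r • N ⊓ Z ≤ 𝔞 ^ t • (N ⊓ Z) := by
  obtain ⟨k, hk⟩ := ((𝔞.stableFiltration_stable N).inter_right
    (𝔞.trivialFiltration Z)).exists_pow_smul_eq_of_ge
  refine ⟨t + k, ?_⟩
  have := hk (t + k) (by lia)
  simp only [Ideal.Filtration.inf_N, Nat.add_sub_cancel] at this
  change 𝔞 ^ (t + k) • N ⊓ Z = 𝔞 ^ t • (𝔞 ^ k • N ⊓ Z) at this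
  rw [this]
  exact Submodule.smul_mono le_rfl (inf_le_inf_right _ Submodule.smul_le_right)

section Differential

variable (d : L →ₗ[A] L)

lemma exact_inclusion_submoduleMap (N : Submodule A L) :
    Function.Exact (Submodule.inclusion (inf_le_left : N ⊓ d.ker ≤ N)) (d.submoduleMap N) := by
  intro x
  rw [Subtype.ext_iff]
  constructor
  · intro hx
    exact ⟨⟨x, x.2, hx⟩, rfl⟩
  · rintro ⟨y, rfl⟩
    exact y.2.2

/-- The connecting map for `0 → N ∩ ker d → N → d(N) → 0`. -/
abbrev deltaMap (M : ModuleCat.{u} A) (i : ℕ) (N : Submodule A L) :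
    Ext (ModuleCat.of A ↥(N ⊓ d.ker)) M i →ₗ[A] Ext (ModuleCat.of A (N.map d)) M (i + 1) :=
  delta M (Submodule.inclusion_injective _) (d.submoduleMap_surjective N)
    (exact_inclusion_submoduleMap d N) i

lemma deltaMap_res {N' N : Submodule A L} (h : N' ≤ N)
    (ξ : Ext (ModuleCat.of A ↥(N ⊓ d.ker)) M i) :
    deltaMap d M i N' (res M i (inf_le_inf_right d.ker h) ξ) =
      res M (i + 1) (Submodule.map_mono h) (deltaMap d M i N ξ) :=
  delta_naturality (Submodule.inclusion_injective _) (d.submoduleMap_surjective N')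
    (exact_inclusion_submoduleMap d N') (Submodule.inclusion_injective _)
    (d.submoduleMap_surjective N) (exact_inclusion_submoduleMap d N)
    (Submodule.inclusion (inf_le_inf_right d.ker h)) (Submodule.inclusion h)
    (Submodule.inclusion (Submodule.map_mono h)) (LinearMap.ext fun _ => Subtype.ext rfl)
    (LinearMap.ext fun _ => Subtype.ext rfl) ξ

/-- If `d(N)` is effaceable in degree `i + 1`, then a degree `i` class on an open submodule of
`N ∩ ker d` extends to an open submodule of `N` after restriction. -/
lemma Effaceable.exists_extension [IsNoetherianRing A] [Module.Finite A L] {N : Submodule A L}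
    (hB : Effaceable 𝔞 M (i + 1) (N.map d)) {Z' : Submodule A L} {t : ℕ}
    (ht : 𝔞 ^ t • (N ⊓ d.ker) ≤ Z') (ξ : Ext (ModuleCat.of A Z') M i) :
    ∃ (w : ℕ) (hw : 𝔞 ^ w • N ⊓ d.ker ≤ Z') (θ : Ext (ModuleCat.of A ↥(𝔞 ^ w • N)) M i),
      res M i inf_le_left θ = res M i hw ξ := by
  obtain ⟨r, hr⟩ := exists_pow_smul_inf_le (𝔞 := 𝔞) N d.ker t
  have hr' := hr.trans ht
  obtain ⟨s, hs, hs0⟩ := hB ((𝔞 ^ r • N).map d) (Submodule.map_mono Submodule.smul_le_right) r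
    (Submodule.map_smul'' _ _ _).ge (deltaMap d M i _ (res M i hr' ξ))
  have hle : 𝔞 ^ (max r s) • N ≤ 𝔞 ^ r • N := pow_smul_anti (le_max_left _ _) N
  refine ⟨max r s, (inf_le_inf_right _ hle).trans hr', ?_⟩
  apply exists_pull_of_delta_eq_zero (Submodule.inclusion_injective _)
    (d.submoduleMap_surjective _) (exact_inclusion_submoduleMap d _)
  change deltaMap d M i _ _ = 0
  rw [← res_res (inf_le_inf_right d.ker hle) hr', deltaMap_res d hle]
  have h1 : (𝔞 ^ (max r s) • N).map d ≤ 𝔞 ^ s • N.map d := by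
    rw [Submodule.map_smul'']
    exact pow_smul_anti (le_max_right _ _) _
  rw [← res_res h1 hs, hs0, map_zero]

lemma Effaceable.inf_ker [IsNoetherianRing A] [Module.Finite A L] {N : Submodule A L}
    (hN : Effaceable 𝔞 M i N) (hB : Effaceable 𝔞 M (i + 1) (N.map d)) :
    Effaceable 𝔞 M i (N ⊓ d.ker) := by
  intro Z' hZ' t ht ξ
  obtain ⟨w, hw, θ, hθ⟩ := hB.exists_extension d ht ξ
  obtain ⟨s, hs, hs0⟩ := hN (𝔞 ^ w • N) Submodule.smul_le_right w le_rfl θ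
  have h1 : 𝔞 ^ s • (N ⊓ d.ker) ≤ 𝔞 ^ s • N ⊓ d.ker :=
    le_inf (Submodule.smul_mono le_rfl inf_le_left) (Submodule.smul_le_right.trans inf_le_right)
  have h2 : 𝔞 ^ s • N ⊓ d.ker ≤ 𝔞 ^ w • N ⊓ d.ker := inf_le_inf_right _ hs
  refine ⟨s, h1.trans (h2.trans hw), ?_⟩
  rw [← res_res (h1.trans h2) hw, ← hθ, res_res,
    ← res_res (h1.trans inf_le_left) hs, hs0, map_zero]

end Differential

end Restriction

section Ideal

variable {A : Type u} [CommRing A] {M : ModuleCat.{u} A} {𝔞 : Ideal A} {i : ℕ}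

/-- The connecting map for `0 → I → A → A/I → 0`. -/
abbrev deltaQ (M : ModuleCat.{u} A) (i : ℕ) (I : Ideal A) :
    Ext (ModuleCat.of A I) M i →ₗ[A] Ext (ModuleCat.of A (A ⧸ I)) M (i + 1) :=
  delta M (Submodule.subtype_injective I) (Submodule.mkQ_surjective I)
    (LinearMap.exact_subtype_mkQ I) i

lemma deltaQ_res {I J : Ideal A} (h : I ≤ J) (ξ : Ext (ModuleCat.of A J) M i) :
    deltaQ M i I (res M i h ξ) = pull M (i + 1) (Submodule.factor h) (deltaQ M i J ξ) :=
  delta_naturality (Submodule.subtype_injective I) (Submodule.mkQ_surjective I)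
    (LinearMap.exact_subtype_mkQ I) (Submodule.subtype_injective J) (Submodule.mkQ_surjective J)
    (LinearMap.exact_subtype_mkQ J) (Submodule.inclusion h) LinearMap.id
    (Submodule.factor h) (LinearMap.ext fun _ => rfl) (LinearMap.ext fun _ => rfl) ξ

/-- The colimit of `Ext^i(A/𝔞^t, M)` along the transition maps vanishes. -/
def ColimitVanishes (𝔞 : Ideal A) (M : ModuleCat.{u} A) (i : ℕ) : Prop :=
  ∀ (t : ℕ) (ζ : Ext (ModuleCat.of A (A ⧸ 𝔞 ^ t)) M i), ∃ (s : ℕ) (h : 𝔞 ^ s ≤ 𝔞 ^ t),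
    pull M i (Submodule.factor h) ζ = 0

lemma ColimitVanishes.exists_res_eq_zero (hv : ColimitVanishes 𝔞 M (i + 2)) {t : ℕ}
    (ξ : Ext (ModuleCat.of A ↥(𝔞 ^ t)) M (i + 1)) :
    ∃ (s : ℕ) (h : 𝔞 ^ s ≤ 𝔞 ^ t), res M (i + 1) h ξ = 0 := by
  obtain ⟨s, h, hs⟩ := hv t (deltaQ M (i + 1) _ ξ)
  refine ⟨s, h, ?_⟩
  rw [← deltaQ_res] at hs
  obtain ⟨θ, hθ⟩ := exists_pull_of_delta_eq_zero (Submodule.subtype_injective _)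
    (Submodule.mkQ_surjective _) (LinearMap.exact_subtype_mkQ _) hs
  rw [← hθ, θ.eq_zero_of_projective, map_zero]

variable {L : Type u} [AddCommGroup L] [Module A L]

lemma apply_mem_of_mem_smul {I : Ideal A} {N : Submodule A L} (f : N →ₗ[A] A)
    (x : ↥(I • N)) : f (Submodule.inclusion Submodule.smul_le_right x) ∈ I := by
  obtain ⟨x, hx⟩ := x
  induction hx using Submodule.smul_induction_on' with
  | smul a ha n hn =>
    have : f (Submodule.inclusion Submodule.smul_le_right
      ⟨a • n, Submodule.smul_mem_smul ha hn⟩) = a * f ⟨n, hn⟩ := by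
      rw [← smul_eq_mul, ← map_smul]; rfl
    rw [this]
    exact I.mul_mem_right _ ha
  | add x hx y hy h1 h2 =>
    convert I.add_mem h1 h2
    rw [← map_add]
    rfl

lemma ColimitVanishes.effaceable_of_free (hv : ColimitVanishes 𝔞 M (i + 2)) (N : Submodule A L)
    [Module.Free A N] [Module.Finite A N] : Effaceable 𝔞 M (i + 1) N := by
  intro N' hN' t ht ξ
  let b := Module.Free.chooseBasis A N
  have hb (j) (I : Ideal A) (hI : I ≤ 𝔞 ^ t) :
      ∀ a ∈ I, LinearMap.toSpanSingleton A L (b j) a ∈ N' := fun a ha =>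
    ht (Submodule.smul_mem_smul (hI ha) (b j).2)
  choose s hs hs0 using fun j => hv.exists_res_eq_zero (pull M (i + 1)
    ((LinearMap.toSpanSingleton A L (b j)).restrict (hb j _ le_rfl)) ξ)
  let r := max t (Finset.univ.sup s)
  have hr : 𝔞 ^ r ≤ 𝔞 ^ t := Ideal.pow_le_pow_right (le_max_left _ _)
  have hN : 𝔞 ^ r • N ≤ N' := (Submodule.smul_mono_left hr).trans ht
  refine ⟨r, hN, ?_⟩
  have hsum : Submodule.inclusion hN = ∑ j,
      ((LinearMap.toSpanSingleton A L (b j)).restrict (hb j _ hr)) ∘ₗ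
        (LinearMap.codRestrict (𝔞 ^ r)
          ((b.coord j) ∘ₗ Submodule.inclusion Submodule.smul_le_right)
          (apply_mem_of_mem_smul (b.coord j))) := by
    ext x
    have := congrArg N.subtype (b.sum_repr (Submodule.inclusion Submodule.smul_le_right x))
    simp only [map_sum, map_smul] at this
    simpa [LinearMap.sum_apply] using this.symm
  rw [res, hsum, pull_sum]
  refine Finset.sum_eq_zero fun j _ => ?_
  rw [← pull_pull]
  have h1 : 𝔞 ^ r ≤ 𝔞 ^ s j := Ideal.pow_le_pow_right
    ((Finset.le_sup (Finset.mem_univ j)).trans (le_max_right _ _))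
  have := congrArg (res M (i + 1) h1) (hs0 j)
  rw [map_zero, res_res, res, pull_pull] at this
  convert map_zero (pull M (i + 1) _)
  exact this

end Ideal

section Koszul

open ExteriorAlgebra

variable {A : Type u} [CommRing A] {n : ℕ} (x : Fin n → A)

/-- The Koszul differential of a sequence `x`, on the whole exterior algebra. -/
def koszul : ExteriorAlgebra A (Fin n → A) →ₗ[A] ExteriorAlgebra A (Fin n → A) :=
  LinearMap.mulLeft A (ι A x)

lemma koszul_apply (ω : ExteriorAlgebra A (Fin n → A)) : koszul x ω = ι A x * ω := rfl

lemma koszul_koszul (ω : ExteriorAlgebra A (Fin n → A)) : koszul x (koszul x ω) = 0 := by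
  rw [koszul_apply, koszul_apply, ← mul_assoc, ι_sq_zero, zero_mul]

lemma map_koszul_le (p : ℕ) :
    (⋀[A]^p (Fin n → A)).map (koszul x) ≤ ⋀[A]^(p + 1) (Fin n → A) ⊓ (koszul x).ker := by
  rw [Submodule.map_le_iff_le_comap]
  intro ω hω
  refine ⟨?_, koszul_koszul x ω⟩
  change koszul x ω ∈ LinearMap.range (ι A) ^ (p + 1)
  rw [koszul_apply, pow_succ']
  exact Submodule.mul_mem_mul ⟨x, rfl⟩ hω

/-- Contraction of an exterior form with the `j`-th coordinate. -/
def contract (j : Fin n) :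
    ExteriorAlgebra A (Fin n → A) →ₗ[A] ExteriorAlgebra A (Fin n → A) :=
  CliffordAlgebra.contractLeft (Q := 0) (LinearMap.proj j)

lemma contract_ι_mul (j : Fin n) (v : Fin n → A) (ω : ExteriorAlgebra A (Fin n → A)) :
    contract j (ι A v * ω) = v j • ω - ι A v * contract j ω :=
  CliffordAlgebra.contractLeft_ι_mul ..

lemma contract_mem (j : Fin n) (p : ℕ) {ω : ExteriorAlgebra A (Fin n → A)}
    (hω : ω ∈ ⋀[A]^(p + 1) (Fin n → A)) : contract j ω ∈ ⋀[A]^p (Fin n → A) := by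
  induction p generalizing ω with
  | zero =>
    replace hω : ω ∈ LinearMap.range (ι A : (Fin n → A) →ₗ[A] _) ^ (0 + 1) := hω
    rw [zero_add, pow_one] at hω
    obtain ⟨v, rfl⟩ := hω
    change _ ∈ LinearMap.range (ι A) ^ 0
    rw [pow_zero, Submodule.mem_one]
    exact ⟨v j, (CliffordAlgebra.contractLeft_ι (Q := 0) (LinearMap.proj j) v).symm⟩
  | succ p ih =>
    replace hω : ω ∈ LinearMap.range (ι A : (Fin n → A) →ₗ[A] _) ^ (p + 1 + 1) := hω
    rw [pow_succ'] at hω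
    induction hω using Submodule.mul_induction_on' with
    | mem_mul_mem a ha b hb =>
      obtain ⟨v, rfl⟩ := ha
      rw [contract_ι_mul]
      refine Submodule.sub_mem _ (Submodule.smul_mem _ _ hb) ?_
      change _ ∈ LinearMap.range (ι A) ^ (p + 1)
      rw [pow_succ']
      exact Submodule.mul_mem_mul ⟨v, rfl⟩ (ih hb)
    | add a _ b _ ha hb => rw [map_add]; exact Submodule.add_mem _ ha hb

/-- Contractions are homotopies witnessing that the ideal `(x)` kills Koszul cohomology. -/
lemma koszul_contract (j : Fin n) {ω : ExteriorAlgebra A (Fin n → A)} (hω : koszul x ω = 0) :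
    koszul x (contract j ω) = x j • ω := by
  have := contract_ι_mul j x ω
  rw [← koszul_apply, hω, map_zero, ← koszul_apply] at this
  exact (sub_eq_zero.1 this.symm).symm

lemma span_smul_le (p : ℕ) :
    Ideal.span (Set.range x) • (⋀[A]^(p + 1) (Fin n → A) ⊓ (koszul x).ker) ≤
      (⋀[A]^p (Fin n → A)).map (koszul x) := by
  rw [Submodule.smul_le]
  intro a ha ω hω
  induction ha using Submodule.span_induction with
  | mem a ha =>
    obtain ⟨j, rfl⟩ := ha
    exact ⟨contract j ω, contract_mem j p hω.1, koszul_contract x j hω.2⟩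
  | zero => simp
  | add a b _ _ ha hb => rw [add_smul]; exact Submodule.add_mem _ ha hb
  | smul c a _ ha => rw [smul_assoc]; exact Submodule.smul_mem _ _ ha

instance finite_exteriorAlgebra : Module.Finite A (ExteriorAlgebra A (Fin n → A)) :=
  .of_basis (Pi.basisFun A (Fin n)).ExteriorAlgebra

lemma exteriorPower_eq_bot {p : ℕ} (hp : n < p) : ⋀[A]^p (Fin n → A) = ⊥ := by
  have : IsEmpty (Set.powersetCard (Fin n) p) := by
    refine ⟨fun s => ?_⟩
    have h1 : s.1.card = p := s.2
    have h2 := Finset.card_le_univ s.1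
    rw [h1, Fintype.card_fin] at h2
    lia
  have := ((Pi.basisFun A (Fin n)).exteriorPower p).repr.toEquiv.subsingleton
  exact (Submodule.subsingleton_iff_eq_bot).1 this

/-- The differential of the Koszul complex in degree zero. -/
def koszulZero : A →ₗ[A] ExteriorAlgebra A (Fin n → A) :=
  LinearMap.toSpanSingleton A _ (ι A x)

lemma map_koszulZero_top :
    Submodule.map (koszulZero x) ⊤ = (⋀[A]^0 (Fin n → A)).map (koszul x) := by
  have : ⋀[A]^0 (Fin n → A) = LinearMap.range (Algebra.linearMap A _) := by
    rw [← Submodule.one_eq_range]; exact pow_zero _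
  rw [this, ← LinearMap.range_eq_map, ← LinearMap.range_comp]
  congr 1
  ext
  simp [koszulZero, koszul_apply]

lemma span_smul_ker_koszulZero : Ideal.span (Set.range x) • (koszulZero x).ker = ⊥ := by
  rw [eq_bot_iff, Submodule.smul_le]
  intro a ha b hb
  replace hb : b • ι A x = 0 := hb
  rw [← map_smul, ι_eq_zero_iff] at hb
  induction ha using Submodule.span_induction with
  | mem a ha =>
    obtain ⟨j, rfl⟩ := ha
    simpa [mul_comm] using congrFun hb j
  | zero => simp
  | add a a' _ _ ha hb => rw [add_smul]; exact Submodule.add_mem _ ha hb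
  | smul c a _ ha => rw [smul_assoc]; exact Submodule.smul_mem _ _ ha

variable [IsNoetherianRing A] {𝔞 : Ideal A} {M : ModuleCat.{u} A} {c : ℕ} {x}

lemma effaceable_cocycles (hx : Ideal.span (Set.range x) = 𝔞)
    (hv : ∀ i, c < i → ColimitVanishes 𝔞 M i) (hc : 0 < c) (k : ℕ) :
    ∀ p, n < p + k → ∀ i, c ≤ i →
      Effaceable 𝔞 M i (⋀[A]^p (Fin n → A) ⊓ (koszul x).ker) := by
  induction k with
  | zero =>
    intro p hp i _
    rw [exteriorPower_eq_bot (p := p) hp, bot_inf_eq]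
    exact .bot
  | succ k ih =>
    intro p hp i hi
    have h1 : Effaceable 𝔞 M (i + 1) ((⋀[A]^p (Fin n → A)).map (koszul x)) :=
      (ih (p + 1) (by lia) (i + 1) (by lia)).mono (map_koszul_le x p) (r := 1)
        (by rw [pow_one, ← hx]; exact span_smul_le x p)
    obtain ⟨i, rfl⟩ : ∃ j, i = j + 1 := ⟨i - 1, by lia⟩
    exact ((hv (i + 2) (by lia)).effaceable_of_free _).inf_ker _ h1

lemma effaceable_boundaries (hx : Ideal.span (Set.range x) = 𝔞)
    (hv : ∀ i, c < i → ColimitVanishes 𝔞 M i) (hc : 0 < c) (p : ℕ) :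
    Effaceable 𝔞 M c ((⋀[A]^p (Fin n → A)).map (koszul x)) :=
  (effaceable_cocycles hx hv hc n (p + 1) (by lia) c le_rfl).mono (map_koszul_le x p) (r := 1)
        (by rw [pow_one, ← hx]; exact span_smul_le x p)

lemma exists_res_eq_sum (hx : Ideal.span (Set.range x) = 𝔞)
    (hv : ∀ i, c + 1 < i → ColimitVanishes 𝔞 M i) (t : ℕ)
    (η : Ext (ModuleCat.of A ↥(𝔞 ^ t)) M c) :
    ∃ (s : ℕ) (h : 𝔞 ^ s ≤ 𝔞 ^ t) (ζ : Fin n → Ext (ModuleCat.of A ↥(𝔞 ^ s)) M c),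
      res M c h η = ∑ j, x j • ζ j := by
  obtain ⟨r, hr⟩ := exists_pow_smul_inf_le (𝔞 := 𝔞) (⊤ : Ideal A) (koszulZero x).ker 1
  rw [pow_one, top_inf_eq, ← hx, span_smul_ker_koszulZero x, hx, smul_eq_mul, Ideal.mul_top] at hr
  let m := max r t
  have hmr : 𝔞 ^ m ≤ 𝔞 ^ r := Ideal.pow_le_pow_right (le_max_left _ _)
  have hmt : 𝔞 ^ m ≤ 𝔞 ^ t := Ideal.pow_le_pow_right (le_max_right _ _)
  have hinj : Function.Injective ((koszulZero x).submoduleMap (𝔞 ^ m)) := by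
    rw [injective_iff_map_eq_zero]
    intro a ha
    exact Subtype.ext (hr ⟨hmr a.2, congrArg Subtype.val ha⟩)
  let e := LinearEquiv.ofBijective _ ⟨hinj, (koszulZero x).submoduleMap_surjective (𝔞 ^ m)⟩
  have ht : 𝔞 ^ (m + 1) • (⋀[A]^1 (Fin n → A) ⊓ (koszul x).ker) ≤
      Submodule.map (koszulZero x) (𝔞 ^ m) := by
    rw [pow_succ, mul_smul]
    refine (Submodule.smul_mono le_rfl (hx ▸ span_smul_le x 0)).trans ?_
    rw [← map_koszulZero_top x, ← Submodule.map_smul'', smul_eq_mul, Ideal.mul_top]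
  obtain ⟨w, hw, θ, hθ⟩ := (effaceable_boundaries hx hv c.succ_pos 1).exists_extension
    (koszul x) ht (pull M c e.symm.toLinearMap (res M c hmt η))
  let s := max m w
  have hsm : 𝔞 ^ s ≤ 𝔞 ^ m := Ideal.pow_le_pow_right (le_max_left _ _)
  have hsw : 𝔞 ^ s ≤ 𝔞 ^ w := Ideal.pow_le_pow_right (le_max_right _ _)
  have hmem (v : Fin n → A) : ∀ a ∈ 𝔞 ^ s,
      LinearMap.toSpanSingleton A _ (ι A v) a ∈ 𝔞 ^ w • ⋀[A]^1 (Fin n → A) := by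
    intro a ha
    refine Submodule.smul_mem_smul (hsw ha) ?_
    change _ ∈ LinearMap.range (ι A) ^ 1
    rw [pow_one]
    exact ⟨v, rfl⟩
  have hmem' : ∀ a ∈ 𝔞 ^ s, koszulZero x a ∈ 𝔞 ^ w • ⋀[A]^1 (Fin n → A) ⊓ (koszul x).ker := by
    intro a ha
    refine ⟨hmem x a ha, ?_⟩
    change ι A x * (a • ι A x) = 0
    rw [mul_smul_comm, ι_sq_zero, smul_zero]
  refine ⟨s, hsm.trans hmt, fun j => pull M c ((LinearMap.toSpanSingleton A _
    (ι A (Pi.single j 1))).restrict (hmem (Pi.single j 1))) θ, ?_⟩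
  have key := congrArg (pull M c ((koszulZero x).restrict hmem')) hθ
  simp only [res, pull_pull] at key
  have h1 : (e.symm.toLinearMap ∘ₗ Submodule.inclusion hw) ∘ₗ (koszulZero x).restrict hmem' =
      Submodule.inclusion hsm := by
    refine LinearMap.ext fun a => ?_
    change e.symm _ = _
    rw [LinearEquiv.symm_apply_eq]
    rfl
  have h2 : Submodule.inclusion (inf_le_left : 𝔞 ^ w • ⋀[A]^1 (Fin n → A) ⊓ (koszul x).ker ≤ _)
      ∘ₗ (koszulZero x).restrict hmem' = ∑ j, x j • ((LinearMap.toSpanSingleton A _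
    (ι A (Pi.single j 1))).restrict (hmem (Pi.single j 1))) := by
    refine LinearMap.ext fun a => Subtype.ext ?_
    have : ι A x = ∑ j, x j • ι A (Pi.single j 1) := by
      conv_lhs => rw [pi_eq_sum_univ' x]
      rw [map_sum]
      simp only [map_smul]
    change (a : A) • ι A x = _
    simp only [this, LinearMap.sum_apply, AddSubmonoidClass.coe_finsetSum, Finset.smul_sum]
    exact Finset.sum_congr rfl fun j _ => smul_comm _ _ _
  rw [h2, pull_sum] at key
  simp only [pull_smul] at key
  rw [key]
  change _ = pull M c (Submodule.inclusion hmt ∘ₗ (e.symm.toLinearMap ∘ₗ Submodule.inclusion hw) ∘ₗ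
    (koszulZero x).restrict hmem') η
  rw [h1]
  rfl

lemma exists_pull_eq_sum (hx : Ideal.span (Set.range x) = 𝔞)
    (hv : ∀ i, c + 1 < i → ColimitVanishes 𝔞 M i) (t : ℕ)
    (ξ : Ext (ModuleCat.of A (A ⧸ 𝔞 ^ t)) M (c + 1)) :
    ∃ (s : ℕ) (h : 𝔞 ^ s ≤ 𝔞 ^ t) (ζ : Fin n → Ext (ModuleCat.of A (A ⧸ 𝔞 ^ s)) M (c + 1)),
      pull M (c + 1) (Submodule.factor h) ξ = ∑ j, x j • ζ j := by
  obtain ⟨η, rfl⟩ := exists_delta_of_pull_eq_zero (ζ := ξ) (Submodule.subtype_injective (𝔞 ^ t))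
    (Submodule.mkQ_surjective _) (LinearMap.exact_subtype_mkQ _) (Ext.eq_zero_of_projective _)
  obtain ⟨s, h, ζ, hζ⟩ := exists_res_eq_sum hx hv t η
  refine ⟨s, h, fun j => deltaQ M c _ (ζ j), ?_⟩
  rw [← deltaQ_res, hζ, map_sum]
  simp only [map_smul]

end Koszul

lemma smul_ext_eq_zero {A : Type u} [CommRing A] {M : ModuleCat.{u} A} {I : Ideal A} {a : A}
    (ha : a ∈ I) {i : ℕ} (ξ : Ext (ModuleCat.of A (A ⧸ I)) M i) : a • ξ = 0 := by
  have : a • (LinearMap.id : A ⧸ I →ₗ[A] A ⧸ I) = 0 := by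
    refine LinearMap.ext fun y => ?_
    obtain ⟨y, rfl⟩ := Submodule.mkQ_surjective I y
    rw [LinearMap.smul_apply, LinearMap.id_apply, ← map_smul, LinearMap.zero_apply,
      Submodule.mkQ_apply, Submodule.Quotient.mk_eq_zero]
    exact I.mul_mem_right _ ha
  rw [← pull_id M i ξ, ← pull_smul, this, pull_zero]

section OppositeHomology

open Opposite

variable {A : Type u} [CommRing A] (K K' : ChainComplex (ModuleCat.{u} A)ᵒᵖ ℕ) (n : ℕ)

/-- The projection from cocycles to cohomology for the cochain complex of modules opposite
to `K`. -/
def toCohomology : (K.opcycles n).unop →ₗ[A] (K.homology n).unop :=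
  (K.homologyι n).unop.hom

/-- The inclusion of cocycles in cochains for the cochain complex of modules opposite to `K`. -/
def toCochain : (K.opcycles n).unop →ₗ[A] (K.X n).unop :=
  (K.pOpcycles n).unop.hom

lemma toCohomology_surjective : Function.Surjective (toCohomology K n) :=
  (ModuleCat.epi_iff_surjective _).1 inferInstance

lemma toCochain_injective : Function.Injective (toCochain K n) :=
  (ModuleCat.mono_iff_injective _).1 inferInstance

lemma d_toCochain (z : (K.opcycles n).unop) :
    (K.d (n + 1) n).unop.hom (toCochain K n z) = 0 := by
  have := congrArg Quiver.Hom.unop (K.d_pOpcycles (n + 1) n)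
  exact congrArg (fun f => f.hom z) this

lemma exists_toCochain_eq (y : (K.X n).unop) (hy : (K.d (n + 1) n).unop.hom y = 0) :
    ∃ z, toCochain K n z = y := by
  have h : (ShortComplex.mk _ _ (K.d_pOpcycles (n + 1) n)).Exact :=
    ShortComplex.exact_of_g_is_cokernel _ (K.opcyclesIsCokernel _ _ (by simp))
  exact (ShortComplex.ShortExact.moduleCat_exact_iff_function_exact _).1 h.unop y |>.1 hy

lemma toCohomology_eq_zero_iff (z : (K.opcycles (n + 1)).unop) :
    toCohomology K (n + 1) z = 0 ↔
      ∃ y, (K.d (n + 1) n).unop.hom y = toCochain K (n + 1) z := by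
  have h : (ShortComplex.mk _ _ (K.homologyι_comp_fromOpcycles (n + 1) n)).Exact :=
    ShortComplex.exact_of_f_is_kernel _ (K.homologyIsKernel _ _ (by simp))
  have h1 : toCohomology K (n + 1) z = 0 ↔ ∃ y, (K.fromOpcycles (n + 1) n).unop.hom y = z :=
    (ShortComplex.ShortExact.moduleCat_exact_iff_function_exact _).1 h.unop z
  have h2 (y) : (K.d (n + 1) n).unop.hom y =
      toCochain K (n + 1) ((K.fromOpcycles (n + 1) n).unop.hom y) := by
    have := congrArg Quiver.Hom.unop (K.p_fromOpcycles (n + 1) n)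
    exact congrArg (fun f => f.hom y) this.symm
  rw [h1]
  simp only [h2, (toCochain_injective K (n + 1)).eq_iff]

variable {K K'} (φ : K ⟶ K')

lemma toCohomology_naturality (z : (K'.opcycles n).unop) :
    (HomologicalComplex.homologyMap φ n).unop.hom (toCohomology K' n z) =
      toCohomology K n ((HomologicalComplex.opcyclesMap φ n).unop.hom z) := by
  have := congrArg Quiver.Hom.unop (HomologicalComplex.homologyι_naturality φ n)
  exact congrArg (fun f => f.hom z) this

lemma toCochain_naturality (z : (K'.opcycles n).unop) :
    (φ.f n).unop.hom (toCochain K' n z) =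
      toCochain K n ((HomologicalComplex.opcyclesMap φ n).unop.hom z) := by
  have := congrArg Quiver.Hom.unop (HomologicalComplex.p_opcyclesMap φ n)
  exact congrArg (fun f => f.hom z) this.symm

end OppositeHomology

section Comparison

open Opposite

variable {A : Type u} [CommRing A] {X Y : ModuleCat.{u} A} (P : ProjectiveResolution X)
  (Q : ProjectiveResolution Y) (M : ModuleCat.{u} A) (n : ℕ)

/-- The complex `Hom(P, M)`, in the opposite category. -/
abbrev homComplex : ChainComplex (ModuleCat.{u} A)ᵒᵖ ℕ :=
  (((linearYoneda A (ModuleCat.{u} A)).obj M).rightOp.mapHomologicalComplex _).obj P.complex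

/-- Cocycles as morphisms. -/
def toHom : ((homComplex P M).opcycles n).unop →ₗ[A] (P.complex.X n ⟶ M) :=
  toCochain (homComplex P M) n

lemma d_comp_toHom (z : ((homComplex P M).opcycles n).unop) :
    P.complex.d (n + 1) n ≫ toHom P M n z = 0 :=
  d_toCochain (homComplex P M) n z

/-- The comparison of the cohomology of `Hom(P, M)` with the derived functor `Ext`. -/
def homologyToDerivedExt : ((homComplex P M).homology n).unop →ₗ[A]
    ((_root_.Ext A (ModuleCat.{u} A) n).obj (op X)).obj M :=
  (P.isoLeftDerivedObj ((linearYoneda A (ModuleCat.{u} A)).obj M).rightOp n).hom.unop.hom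

lemma homologyToDerivedExt_bijective : Function.Bijective (homologyToDerivedExt P M n) :=
  ⟨(ModuleCat.mono_iff_injective _).1 (inferInstanceAs (Mono (P.isoLeftDerivedObj
      ((linearYoneda A (ModuleCat.{u} A)).obj M).rightOp n).hom.unop)),
    (ModuleCat.epi_iff_surjective _).1 (inferInstanceAs (Epi (P.isoLeftDerivedObj
      ((linearYoneda A (ModuleCat.{u} A)).obj M).rightOp n).hom.unop))⟩

/-- The comparison of cocycles with the derived functor `Ext`. -/
def toDerivedExt : ((homComplex P M).opcycles n).unop →ₗ[A]
    ((_root_.Ext A (ModuleCat.{u} A) n).obj (op X)).obj M :=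
  homologyToDerivedExt P M n ∘ₗ toCohomology _ n

/-- The comparison of cocycles with `Ext` in the derived category. -/
def toExt : ((homComplex P M).opcycles n).unop →ₗ[A] Ext X M n where
  toFun z := P.extMk (toHom P M n z) (n + 1) rfl (d_comp_toHom P M n z)
  map_add' y z := by simp only [P.add_extMk, map_add]
  map_smul' a z := by
    simp only [RingHom.id_apply, Ext.smul_eq_comp_mk₀, P.extMk_comp_mk₀, map_smul,
      Linear.comp_smul, Category.comp_id]

lemma toDerivedExt_surjective : Function.Surjective (toDerivedExt P M n) :=
  (homologyToDerivedExt_bijective P M n).2.comp (toCohomology_surjective _ n)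

lemma toExt_surjective : Function.Surjective (toExt P M n) := by
  intro ξ
  obtain ⟨f, hf, rfl⟩ := P.extMk_surjective ξ (n + 1) rfl
  obtain ⟨z, rfl⟩ := exists_toCochain_eq (homComplex P M) n f hf
  exact ⟨z, rfl⟩

lemma ker_toDerivedExt : (toDerivedExt P M (n + 1)).ker = (toExt P M (n + 1)).ker := by
  ext z
  change homologyToDerivedExt P M _ (toCohomology _ _ z) = 0 ↔
    P.extMk (toHom P M _ z) _ rfl (d_comp_toHom P M _ z) = 0
  rw [map_eq_zero_iff _ (homologyToDerivedExt_bijective P M _).1, toCohomology_eq_zero_iff,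
    P.extMk_eq_zero_iff _ _ _ _ n rfl]
  rfl

variable {P Q M n} in
lemma toDerivedExt_naturality {f : X ⟶ Y} (φ : ProjectiveResolution.Hom P Q f)
    (z : ((homComplex Q M).opcycles n).unop) :
    (((_root_.Ext A (ModuleCat.{u} A) n).map f.op).app M).hom (toDerivedExt Q M n z) =
      toDerivedExt P M n ((HomologicalComplex.opcyclesMap
        ((((linearYoneda A (ModuleCat.{u} A)).obj M).rightOp.mapHomologicalComplex _).map
          φ.hom) n).unop.hom z) := by
  have h := congrArg Quiver.Hom.unop (ProjectiveResolution.isoLeftDerivedObj_hom_naturality f P Q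
    φ.hom (by simpa using φ.hom_f_zero_comp_π_f_zero)
    ((linearYoneda A (ModuleCat.{u} A)).obj M).rightOp n)
  have h' := congrArg (fun g => g.hom (toCohomology (homComplex Q M) n z)) h
  refine h'.trans ?_
  exact congrArg (homologyToDerivedExt P M n) (toCohomology_naturality n _ z)

variable {P Q M n} in
lemma toExt_naturality {f : X ⟶ Y} (φ : ProjectiveResolution.Hom P Q f)
    (z : ((homComplex Q M).opcycles n).unop) :
    (Ext.mk₀ f).comp (toExt Q M n z) (zero_add n) =
      toExt P M n ((HomologicalComplex.opcyclesMap
        ((((linearYoneda A (ModuleCat.{u} A)).obj M).rightOp.mapHomologicalComplex _).map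
          φ.hom) n).unop.hom z) := by
  refine (ProjectiveResolution.mk₀_comp_extMk _ _ rfl (d_comp_toHom Q M n z) φ).trans ?_
  have : φ.hom.f n ≫ toHom Q M n z = toHom P M n ((HomologicalComplex.opcyclesMap
        ((((linearYoneda A (ModuleCat.{u} A)).obj M).rightOp.mapHomologicalComplex _).map
          φ.hom) n).unop.hom z) :=
    toCochain_naturality n ((((linearYoneda A (ModuleCat.{u} A)).obj M).rightOp.mapHomologicalComplex
      _).map φ.hom) z
  simp only [this]
  rfl

/-- The derived functor `Ext` and the `Ext` groups of the derived category agree in positive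
degrees. -/
def extEquiv : ((_root_.Ext A (ModuleCat.{u} A) (n + 1)).obj (op X)).obj M ≃ₗ[A]
    Ext X M (n + 1) :=
  ((toDerivedExt (projectiveResolution X) M (n + 1)).quotKerEquivOfSurjective
    (toDerivedExt_surjective _ M (n + 1))).symm ≪≫ₗ
  Submodule.quotEquivOfEq _ _ (ker_toDerivedExt _ M n) ≪≫ₗ
  ((toExt (projectiveResolution X) M (n + 1)).quotKerEquivOfSurjective
    (toExt_surjective _ M (n + 1)))

lemma extEquiv_toDerivedExt (z : ((homComplex (projectiveResolution X) M).opcycles (n + 1)).unop) :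
    extEquiv M n (toDerivedExt (projectiveResolution X) M (n + 1) z) =
      toExt (projectiveResolution X) M (n + 1) z := by
  simp [extEquiv]

lemma extEquiv_naturality (f : X ⟶ Y)
    (ξ : ((_root_.Ext A (ModuleCat.{u} A) (n + 1)).obj (op Y)).obj M) :
    extEquiv M n ((((_root_.Ext A (ModuleCat.{u} A) (n + 1)).map f.op).app M).hom ξ) =
      (Ext.mk₀ f).comp (extEquiv M n ξ) (zero_add _) := by
  obtain ⟨z, rfl⟩ := toDerivedExt_surjective (projectiveResolution Y) M (n + 1) ξ
  let φ : ProjectiveResolution.Hom (projectiveResolution X) (projectiveResolution Y) f :=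
    { hom := ProjectiveResolution.lift f _ _
      hom_f_zero_comp_π_f_zero := by
        simpa using ProjectiveResolution.lift_commutes_zero f _ _ }
  rw [toDerivedExt_naturality φ, extEquiv_toDerivedExt, extEquiv_toDerivedExt, toExt_naturality φ]

end Comparison

section Colimit

open Opposite Limits

variable {A : Type u} [CommRing A] (𝔞 : Ideal A) (M : ModuleCat.{u} A) (n : ℕ)

/-- The direct system `Ext^n(A/𝔞^t, M)` defining local cohomology. -/
abbrev extSystem : (ℕᵒᵖ)ᵒᵖ ⥤ ModuleCat.{u} A :=
  localCohomology.diagram (localCohomology.idealPowersDiagram 𝔞) n ⋙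
    (evaluation (ModuleCat.{u} A) (ModuleCat.{u} A)).obj M

/-- The cocone exhibiting `H^n_𝔞(M)` as the colimit of `extSystem`. -/
abbrev localCohomologyCocone : Cocone (extSystem 𝔞 M n) :=
  ((evaluation (ModuleCat.{u} A) (ModuleCat.{u} A)).obj M).mapCocone
    (colimit.cocone (localCohomology.diagram (localCohomology.idealPowersDiagram 𝔞) n))

/-- Local cohomology is the colimit of `extSystem`. -/
def isColimitLocalCohomologyCocone : IsColimit (localCohomologyCocone 𝔞 M n) :=
  isColimitOfPreserves _ (colimit.isColimit _)

/-- The terms of `extSystem` as `Ext` groups of the derived category. -/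
def systemEquiv (t : ℕ) : (extSystem 𝔞 M (n + 1)).obj (op (op t)) ≃ₗ[A]
    Ext (ModuleCat.of A (A ⧸ 𝔞 ^ t)) M (n + 1) :=
  extEquiv (X := ModuleCat.of A (A ⧸ 𝔞 ^ t)) M n

/-- The canonical map from a term of `extSystem` to its colimit. -/
def ofSystem (t : ℕ) : (extSystem 𝔞 M n).obj (op (op t)) →ₗ[A] (localCohomology 𝔞 n).obj M :=
  ((localCohomologyCocone 𝔞 M n).ι.app (op (op t))).hom

/-- The canonical map `Ext^{n+1}(A/𝔞^t, M) → H^{n+1}_𝔞(M)`. -/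
def toLocalCohomology (t : ℕ) :
    Ext (ModuleCat.of A (A ⧸ 𝔞 ^ t)) M (n + 1) →ₗ[A] (localCohomology 𝔞 (n + 1)).obj M :=
  ofSystem 𝔞 M (n + 1) t ∘ₗ (systemEquiv 𝔞 M n t).symm.toLinearMap

variable {M n}

lemma toLocalCohomology_systemEquiv {t : ℕ} (ξ : (extSystem 𝔞 M (n + 1)).obj (op (op t))) :
    toLocalCohomology 𝔞 M n t (systemEquiv 𝔞 M n t ξ) = ofSystem 𝔞 M (n + 1) t ξ := by
  simp [toLocalCohomology]

lemma systemEquiv_map {s t : ℕ} (hst : t ≤ s)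
    (ξ : (extSystem 𝔞 M (n + 1)).obj (op (op t))) :
    systemEquiv 𝔞 M n s (((extSystem 𝔞 M (n + 1)).map (homOfLE hst).op.op).hom ξ) =
      pull M (n + 1) (Submodule.factor (Ideal.pow_le_pow_right hst)) (systemEquiv 𝔞 M n t ξ) :=
  extEquiv_naturality M n
    (ModuleCat.ofHom (Submodule.factor (Ideal.pow_le_pow_right (I := 𝔞) hst))) ξ

lemma ofSystem_map {s t : ℕ} (hst : t ≤ s) (ξ : (extSystem 𝔞 M n).obj (op (op t))) :
    ofSystem 𝔞 M n s (((extSystem 𝔞 M n).map (homOfLE hst).op.op).hom ξ) =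
      ofSystem 𝔞 M n t ξ :=
  congrArg (fun f => f.hom ξ) ((localCohomologyCocone 𝔞 M n).w (homOfLE hst).op.op)

lemma toLocalCohomology_pull_of_le {s t : ℕ} (hst : t ≤ s)
    (ξ : Ext (ModuleCat.of A (A ⧸ 𝔞 ^ t)) M (n + 1)) :
    toLocalCohomology 𝔞 M n s
      (pull M (n + 1) (Submodule.factor (Ideal.pow_le_pow_right hst)) ξ) =
      toLocalCohomology 𝔞 M n t ξ := by
  obtain ⟨ξ, rfl⟩ := (systemEquiv 𝔞 M n t).surjective ξ
  rw [← systemEquiv_map 𝔞 hst, toLocalCohomology_systemEquiv, toLocalCohomology_systemEquiv,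
    ofSystem_map]

lemma toLocalCohomology_pull {s t : ℕ} (hst : 𝔞 ^ s ≤ 𝔞 ^ t)
    (ξ : Ext (ModuleCat.of A (A ⧸ 𝔞 ^ t)) M (n + 1)) :
    toLocalCohomology 𝔞 M n s (pull M (n + 1) (Submodule.factor hst) ξ) =
      toLocalCohomology 𝔞 M n t ξ := by
  rw [← toLocalCohomology_pull_of_le 𝔞 (le_max_left s t), pull_pull,
    ← toLocalCohomology_pull_of_le 𝔞 (le_max_right s t) ξ, Submodule.factor_comp]

instance preservesColimit_forget : PreservesColimit (extSystem 𝔞 M n)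
    (forget (ModuleCat.{u} A)) := by
  have := preservesFilteredColimitsOfSize_shrink.{0, u, 0, u} (forget (ModuleCat.{u} A))
  have : IsFiltered (ℕᵒᵖ)ᵒᵖ := isFiltered_op_of_isCofiltered _
  infer_instance

lemma exists_toLocalCohomology_eq (y : (localCohomology 𝔞 (n + 1)).obj M) :
    ∃ t ξ, toLocalCohomology 𝔞 M n t ξ = y := by
  obtain ⟨⟨⟨t⟩⟩, ξ, hξ⟩ := Concrete.isColimit_exists_rep (extSystem 𝔞 M (n + 1))
    (isColimitLocalCohomologyCocone 𝔞 M (n + 1)) y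
  exact ⟨t, systemEquiv 𝔞 M n t ξ, (toLocalCohomology_systemEquiv 𝔞 ξ).trans hξ⟩

lemma exists_pull_eq_zero {t : ℕ} {ξ : Ext (ModuleCat.of A (A ⧸ 𝔞 ^ t)) M (n + 1)}
    (hξ : toLocalCohomology 𝔞 M n t ξ = 0) : ∃ (s : ℕ) (h : 𝔞 ^ s ≤ 𝔞 ^ t),
      pull M (n + 1) (Submodule.factor h) ξ = 0 := by
  obtain ⟨ξ, rfl⟩ := (systemEquiv 𝔞 M n t).surjective ξ
  rw [toLocalCohomology_systemEquiv] at hξ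
  have : IsFiltered (ℕᵒᵖ)ᵒᵖ := isFiltered_op_of_isCofiltered _
  obtain ⟨⟨⟨s⟩⟩, f, g, h⟩ := Concrete.isColimit_exists_of_rep_eq (extSystem 𝔞 M (n + 1))
    (isColimitLocalCohomologyCocone 𝔞 M (n + 1)) ξ (0 : (extSystem 𝔞 M (n + 1)).obj (op (op t)))
    (hξ.trans (map_zero (ofSystem 𝔞 M (n + 1) t)).symm)
  have hst : t ≤ s := leOfHom f.unop.unop
  have h0 : ((extSystem 𝔞 M (n + 1)).map (homOfLE hst).op.op).hom ξ = 0 :=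
    h.trans (map_zero ((extSystem 𝔞 M (n + 1)).map g).hom)
  exact ⟨s, Ideal.pow_le_pow_right hst, by rw [← systemEquiv_map 𝔞 hst, h0, map_zero]⟩

lemma colimitVanishes_of_subsingleton (h : Subsingleton ((localCohomology 𝔞 (n + 1)).obj M)) :
    ColimitVanishes 𝔞 M (n + 1) :=
  fun _ _ => exists_pull_eq_zero 𝔞 (Subsingleton.elim _ _)

lemma exists_pow_smul_eq_zero (y : (localCohomology 𝔞 (n + 1)).obj M) :
    ∃ t : ℕ, ∀ a ∈ 𝔞 ^ t, a • y = 0 := by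
  obtain ⟨t, ξ, rfl⟩ := exists_toLocalCohomology_eq 𝔞 y
  exact ⟨t, fun a ha => by rw [← map_smul, smul_ext_eq_zero ha, map_zero]⟩

lemma smul_top_eq_top [IsNoetherianRing A]
    (hv : ∀ i, n + 1 < i → ColimitVanishes 𝔞 M i) :
    𝔞 • (⊤ : Submodule A ((localCohomology 𝔞 (n + 1)).obj M)) = ⊤ := by
  obtain ⟨m, x, hx⟩ := Submodule.fg_iff_exists_fin_generating_family.1 (IsNoetherian.noetherian 𝔞)
  rw [eq_top_iff]
  rintro y -
  obtain ⟨t, ξ, rfl⟩ := exists_toLocalCohomology_eq 𝔞 y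
  obtain ⟨s, h, ζ, hζ⟩ := exists_pull_eq_sum hx hv t ξ
  rw [← toLocalCohomology_pull 𝔞 h, hζ, map_sum]
  refine Submodule.sum_mem _ fun j _ => ?_
  rw [map_smul]
  exact Submodule.smul_mem_smul (hx ▸ Submodule.subset_span ⟨j, rfl⟩) trivial

end Colimit

/-- A finitely generated `𝔞`-torsion module `H` with `𝔞 H = H` vanishes. -/
lemma subsingleton_of_smul_top_eq_top {A H : Type*} [CommRing A] [AddCommGroup H] [Module A H]
    [Module.Finite A H] {𝔞 : Ideal A} (ht : ∀ y : H, ∃ t : ℕ, ∀ a ∈ 𝔞 ^ t, a • y = 0)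
    (h : 𝔞 • (⊤ : Submodule A H) = ⊤) : Subsingleton H := by
  obtain ⟨S, hS⟩ := Module.Finite.fg_top (R := A) (M := H)
  choose t ht using ht
  have h1 : ∀ k : ℕ, 𝔞 ^ k • (⊤ : Submodule A H) = ⊤ := by
    intro k
    induction k with
    | zero => simp
    | succ k ih => rw [pow_succ, mul_smul, h, ih]
  have h2 : 𝔞 ^ S.sup t • (⊤ : Submodule A H) = ⊥ := by
    rw [← hS, eq_bot_iff, Submodule.smul_le]
    intro a ha y hy
    induction hy using Submodule.span_induction with
    | mem y hy => exact ht y a (Ideal.pow_le_pow_right (Finset.le_sup hy) ha)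
    | zero => simp
    | add y z _ _ hy hz => rw [smul_add]; exact Submodule.add_mem _ hy hz
    | smul b y _ hy => rw [smul_comm]; exact Submodule.smul_mem _ _ hy
  rw [h1] at h2
  exact (Submodule.subsingleton_iff A).1 (subsingleton_of_bot_eq_top h2.symm)

end TopLocalCohomology

end

/-- If `c = cd(𝔞, M) > 0` is the cohomological dimension of `M` with respect to `𝔞`
(i.e. `H^c_𝔞(M) ≠ 0` and `H^i_𝔞(M) = 0` for `i > c`), then `H^c_𝔞(M)` is not
finitely generated. -/
theorem top_localCohomology_not_finite
    (A : Type u) [CommRing A] [IsNoetherianRing A]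
    (𝔞 : Ideal A) (M : ModuleCat.{u} A) (c : ℕ) (hc : 0 < c)
    (hne : Nontrivial ((localCohomology 𝔞 c).obj M))
    (hvanish : ∀ i : ℕ, c < i → Subsingleton ((localCohomology 𝔞 i).obj M)) :
    ¬ Module.Finite A ((localCohomology 𝔞 c).obj M) := by
  intro hfin
  obtain ⟨n, rfl⟩ : ∃ n, c = n + 1 := ⟨c - 1, by lia⟩
  refine not_subsingleton ((localCohomology 𝔞 (n + 1)).obj M)
    (TopLocalCohomology.subsingleton_of_smul_top_eq_top
      (TopLocalCohomology.exists_pow_smul_eq_zero (M := M) (n := n) 𝔞)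
      (TopLocalCohomology.smul_top_eq_top 𝔞 fun i hi => ?_))
  obtain ⟨i, rfl⟩ : ∃ j, i = j + 1 := ⟨i - 1, by lia⟩
  exact TopLocalCohomology.colimitVanishes_of_subsingleton 𝔞 (hvanish _ hi)
end

section
/- Let $R$ be a Noetherian integral domain, $I$ an ideal with $c = \operatorname{cd}(I, R)$, and suppose $\operatorname{Supp}_R(\operatorname{D}(\operatorname{H}^c_I(R))) = \operatorname{Spec}(R)$ (equivalently $(0) \in \operatorname{Ass}(\operatorname{D}(\operatorname{H}^c_I(R)))$). If $M$ is a finitely generated torsion-free $R$-module, then $\operatorname{Supp}(\operatorname{D}(\operatorname{H}^{\operatorname{cd}(I,M)}_I(M))) = \operatorname{Spec}(R)$. -/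
open CategoryTheory IsLocalRing

universe u

section
open HomologicalComplex

lemma homologyUnop_hom_naturality {C ι : Type*} [Category* C] [Abelian C] {c : ComplexShape ι}
    {K L : HomologicalComplex Cᵒᵖ c} (φ : K ⟶ L) (i : ι) :
    (homologyUnop L i).hom ≫ (homologyMap φ i).unop =
      homologyMap ((unopFunctor C c).map φ.op) i ≫ (homologyUnop K i).hom := by
  have := homologyOp_hom_naturality ((unopFunctor C c).map φ.op) i
  exact congrArg Quiver.Hom.unop this

section
variable {R : Type u} [CommRing R] {X X' Y Y' : ModuleCat.{u} R}
open ProjectiveResolution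

/-- Precomposition with a morphism of chain complexes, on complexes of morphisms to `Y`. -/
noncomputable def yonedaPrecomp {K L : ChainComplex (ModuleCat.{u} R) ℕ} (φ : K ⟶ L)
    (Y : ModuleCat.{u} R) :
    L.linearYonedaObj R Y ⟶ K.linearYonedaObj R Y :=
  (unopFunctor _ _).map
    ((((linearYoneda R (ModuleCat.{u} R)).obj Y).rightOp.mapHomologicalComplex _).map φ).op

/-- Postcomposition with a morphism of modules, on complexes of morphisms from `K`. -/
noncomputable def yonedaPostcomp (K : ChainComplex (ModuleCat.{u} R) ℕ) {Y Y' : ModuleCat.{u} R}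
    (h : Y ⟶ Y') :
    K.linearYonedaObj R Y ⟶ K.linearYonedaObj R Y' :=
  (unopFunctor _ _).map
    ((NatTrans.mapHomologicalComplex ((linearYoneda R (ModuleCat.{u} R)).map h).rightOp _).app
      K).op

lemma isoExt_inv_naturality_left (P : ProjectiveResolution X) (P' : ProjectiveResolution X')
    (g : X' ⟶ X) (φ : Hom P' P g) (n : ℕ) :
    (P.isoExt (R := R) n Y).inv ≫ ((Ext R (ModuleCat.{u} R) n).map g.op).app Y =
    homologyMap (yonedaPrecomp φ.hom Y) n ≫ (P'.isoExt n Y).inv := by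
  have h1 := isoLeftDerivedObj_hom_naturality g P' P φ.hom
    (by simpa using φ.hom_f_zero_comp_π_f_zero)
    ((linearYoneda R (ModuleCat.{u} R)).obj Y).rightOp n
  have h2 := homologyUnop_hom_naturality
    ((((linearYoneda R (ModuleCat.{u} R)).obj Y).rightOp.mapHomologicalComplex _).map φ.hom) n
  exact (CommSq.horiz_comp (CommSq.mk h2) (CommSq.mk (congrArg Quiver.Hom.unop h1))).w

lemma isoExt_inv_naturality_right (P : ProjectiveResolution X) (h : Y ⟶ Y') (n : ℕ) :
    (P.isoExt (R := R) n Y).inv ≫ ((Ext R (ModuleCat.{u} R) n).obj (.op X)).map h =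
    homologyMap (yonedaPostcomp P.complex h) n ≫ (P.isoExt n Y').inv := by
  have h1 := leftDerived_app_eq ((linearYoneda R (ModuleCat.{u} R)).map h).rightOp P n
  rw [← Category.assoc, Iso.eq_comp_inv] at h1
  have h2 := homologyUnop_hom_naturality
    ((NatTrans.mapHomologicalComplex ((linearYoneda R (ModuleCat.{u} R)).map h).rightOp _).app
      P.complex) n
  exact (CommSq.horiz_comp (CommSq.mk h2) (CommSq.mk (congrArg Quiver.Hom.unop h1))).w

/-- The class in `Ext` of a cocycle of the complex computing it. -/
noncomputable def cocycleClass (P : ProjectiveResolution X) (n : ℕ) (Y : ModuleCat.{u} R) :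
    (P.complex.linearYonedaObj R Y).cycles n ⟶ ((Ext R (ModuleCat.{u} R) n).obj (.op X)).obj Y :=
  (P.complex.linearYonedaObj R Y).homologyπ n ≫ (P.isoExt n Y).inv

lemma cocycleClass_surjective (P : ProjectiveResolution X) (n : ℕ) :
    Function.Surjective (cocycleClass (R := R) P n Y) := by
  rw [← ModuleCat.epi_iff_surjective]
  unfold cocycleClass
  infer_instance

/-- The morphism underlying a cocycle of the complex computing `Ext`. -/
noncomputable def cocycleHom (P : ProjectiveResolution X) (n : ℕ) (Y : ModuleCat.{u} R)
    (z : (P.complex.linearYonedaObj R Y).cycles n) : P.complex.X n ⟶ Y :=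
  (P.complex.linearYonedaObj R Y).iCycles n z

lemma cocycleHom_injective (P : ProjectiveResolution X) (n : ℕ) :
    Function.Injective (cocycleHom (R := R) P n Y) :=
  (ModuleCat.mono_iff_injective ((P.complex.linearYonedaObj R Y).iCycles n)).1 inferInstance

lemma d_comp_cocycleHom (P : ProjectiveResolution X) (n : ℕ)
    (z : (P.complex.linearYonedaObj R Y).cycles n) :
    P.complex.d (n + 1) n ≫ cocycleHom P n Y z = 0 :=
  ConcreteCategory.congr_hom ((P.complex.linearYonedaObj R Y).iCycles_d n (n + 1)) z

lemma exists_cocycleHom_eq (P : ProjectiveResolution X) (n : ℕ) (f : P.complex.X n ⟶ Y)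
    (hf : P.complex.d (n + 1) n ≫ f = 0) :
    ∃ z, cocycleHom (R := R) P n Y z = f := by
  let K := P.complex.linearYonedaObj R Y
  have hex : (ShortComplex.mk (K.iCycles n) (K.d n (n + 1)) (by simp)).Exact :=
    ShortComplex.exact_of_f_is_kernel _ (K.cyclesIsKernel n (n + 1) (by simp))
  rw [ShortComplex.moduleCat_exact_iff] at hex
  exact hex f hf

lemma cocycleHom_cyclesMap_yonedaPrecomp {K : ProjectiveResolution X}
    {K' : ProjectiveResolution X'} (φ : K'.complex ⟶ K.complex) (n : ℕ)
    (z : (K.complex.linearYonedaObj R Y).cycles n) :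
    cocycleHom K' n Y (cyclesMap (yonedaPrecomp φ Y) n z) = φ.f n ≫ cocycleHom K n Y z :=
  ConcreteCategory.congr_hom (cyclesMap_i (yonedaPrecomp φ Y) n) z

lemma cocycleHom_cyclesMap_yonedaPostcomp (P : ProjectiveResolution X) (h : Y ⟶ Y') (n : ℕ)
    (z : (P.complex.linearYonedaObj R Y).cycles n) :
    cocycleHom P n Y' (cyclesMap (yonedaPostcomp P.complex h) n z) = cocycleHom P n Y z ≫ h :=
  ConcreteCategory.congr_hom (cyclesMap_i (yonedaPostcomp P.complex h) n) z

lemma cocycleHom_smul (P : ProjectiveResolution X) (n : ℕ) (r : R)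
    (z : (P.complex.linearYonedaObj R Y).cycles n) :
    cocycleHom P n Y (r • z) = r • cocycleHom P n Y z :=
  map_smul ((P.complex.linearYonedaObj R Y).iCycles n).hom r z

lemma cocycleClass_eq_zero_iff (P : ProjectiveResolution X) (n : ℕ)
    (z : (P.complex.linearYonedaObj R Y).cycles (n + 1)) :
    cocycleClass P (n + 1) Y z = 0 ↔
      ∃ g : P.complex.X n ⟶ Y, P.complex.d (n + 1) n ≫ g = cocycleHom P (n + 1) Y z := by
  let K := P.complex.linearYonedaObj R Y
  have hex : (ShortComplex.mk (K.toCycles n (n + 1)) (K.homologyπ (n + 1)) (by simp)).Exact :=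
    ShortComplex.exact_of_g_is_cokernel _ (K.homologyIsCokernel n (n + 1) (by simp))
  rw [ShortComplex.moduleCat_exact_iff] at hex
  have hinj : Function.Injective (P.isoExt (R := R) (n + 1) Y).inv :=
    (ModuleCat.mono_iff_injective _).1 inferInstance
  have hd (g : K.X n) :
      cocycleHom P (n + 1) Y (K.toCycles n (n + 1) g) = P.complex.d (n + 1) n ≫ g :=
    ConcreteCategory.congr_hom (K.toCycles_i n (n + 1)) g
  constructor
  · intro h
    obtain ⟨g, rfl⟩ := hex z (hinj (by simpa [cocycleClass] using h))
    exact ⟨g, (hd g).symm⟩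
  · rintro ⟨g, hg⟩
    have hz : z = K.toCycles n (n + 1) g := cocycleHom_injective P _ (hg.symm.trans (hd g).symm)
    have h0 : K.toCycles n (n + 1) ≫ cocycleClass P (n + 1) Y = 0 := by
      unfold cocycleClass
      rw [← Category.assoc, toCycles_comp_homologyπ, Limits.zero_comp]
    exact (congrArg (cocycleClass P (n + 1) Y) hz).trans (ConcreteCategory.congr_hom h0 g)

lemma map_cocycleClass_left (P : ProjectiveResolution X) (P' : ProjectiveResolution X')
    (g : X' ⟶ X) (φ : Hom P' P g) (n : ℕ) (z : (P.complex.linearYonedaObj R Y).cycles n) :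
    (((Ext R (ModuleCat.{u} R) n).map g.op).app Y) (cocycleClass P n Y z) =
      cocycleClass P' n Y (cyclesMap (yonedaPrecomp φ.hom Y) n z) := by
  have : cocycleClass P n Y ≫ ((Ext R (ModuleCat.{u} R) n).map g.op).app Y =
      cyclesMap (yonedaPrecomp φ.hom Y) n ≫ cocycleClass P' n Y := by
    simp only [cocycleClass, Category.assoc]
    rw [isoExt_inv_naturality_left P P' g φ, homologyπ_naturality_assoc]
  exact ConcreteCategory.congr_hom this z

lemma map_cocycleClass_right (P : ProjectiveResolution X) (h : Y ⟶ Y') (n : ℕ)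
    (z : (P.complex.linearYonedaObj R Y).cycles n) :
    (((Ext R (ModuleCat.{u} R) n).obj (.op X)).map h) (cocycleClass P n Y z) =
      cocycleClass P n Y' (cyclesMap (yonedaPostcomp P.complex h) n z) := by
  have : cocycleClass P n Y ≫ ((Ext R (ModuleCat.{u} R) n).obj (.op X)).map h =
      cyclesMap (yonedaPostcomp P.complex h) n ≫ cocycleClass P n Y' := by
    simp only [cocycleClass, Category.assoc]
    rw [isoExt_inv_naturality_right P h, homologyπ_naturality_assoc]
  exact ConcreteCategory.congr_hom this z

lemma Ext_map_smul_id (n : ℕ) (X Y : ModuleCat.{u} R) (r : R) :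
    ((Ext R (ModuleCat.{u} R) n).obj (.op X)).map (r • 𝟙 Y) = r • 𝟙 _ := by
  ext a
  let P := projectiveResolution X
  obtain ⟨z, rfl⟩ := cocycleClass_surjective P n a
  have hz : cyclesMap (yonedaPostcomp P.complex (r • 𝟙 Y)) n z = r • z := by
    apply cocycleHom_injective
    rw [cocycleHom_cyclesMap_yonedaPostcomp, cocycleHom_smul]
    simp
  refine (map_cocycleClass_right P _ n z).trans ?_
  rw [hz, map_smul]
  rfl

/-- An element of the derived functor `Ext` and an element of `Abelian.Ext` correspond to each other
if they are represented by the same cocycle. -/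
def ExtRel (P : ProjectiveResolution X) {n : ℕ}
    (a : ((Ext R (ModuleCat.{u} R) n).obj (.op X)).obj Y) (α : Abelian.Ext X Y n) : Prop :=
  ∃ z : (P.complex.linearYonedaObj R Y).cycles n, cocycleClass P n Y z = a ∧
    P.extMk (cocycleHom P n Y z) (n + 1) rfl (d_comp_cocycleHom P n z) = α

lemma ExtRel.exists_right (P : ProjectiveResolution X) {n : ℕ}
    (a : ((Ext R (ModuleCat.{u} R) n).obj (.op X)).obj Y) :
    ∃ α : Abelian.Ext X Y n, ExtRel P a α := by
  obtain ⟨z, rfl⟩ := cocycleClass_surjective P n a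
  exact ⟨_, z, rfl, rfl⟩

lemma ExtRel.exists_left (P : ProjectiveResolution X) {n : ℕ} (α : Abelian.Ext X Y n) :
    ∃ a : ((Ext R (ModuleCat.{u} R) n).obj (.op X)).obj Y, ExtRel P a α := by
  obtain ⟨f, hf, rfl⟩ := P.extMk_surjective α (n + 1) rfl
  obtain ⟨z, hz⟩ := exists_cocycleHom_eq P n f hf
  exact ⟨_, z, rfl, by congr⟩

lemma ExtRel.eq_zero_iff {P : ProjectiveResolution X} {n : ℕ}
    {a : ((Ext R (ModuleCat.{u} R) (n + 1)).obj (.op X)).obj Y}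
    {α : Abelian.Ext X Y (n + 1)} (h : ExtRel P a α) : a = 0 ↔ α = 0 := by
  obtain ⟨z, rfl, rfl⟩ := h
  rw [cocycleClass_eq_zero_iff, P.extMk_eq_zero_iff _ _ _ _ n rfl]

lemma ExtRel.precomp {P : ProjectiveResolution X} {n : ℕ}
    {a : ((Ext R (ModuleCat.{u} R) n).obj (.op X)).obj Y}
    {α : Abelian.Ext X Y n} (h : ExtRel P a α) (P' : ProjectiveResolution X') (g : X' ⟶ X) :
    ExtRel P' (((Ext R (ModuleCat.{u} R) n).map g.op).app Y a)
      ((Abelian.Ext.mk₀ g).comp α (zero_add n)) := by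
  obtain ⟨z, rfl, rfl⟩ := h
  let φ : Hom P' P g := ⟨lift g P' P, by
    simpa using lift_commutes_zero g P' P⟩
  refine ⟨_, (map_cocycleClass_left P P' g φ n z).symm, ?_⟩
  rw [mk₀_comp_extMk _ _ _ _ φ]
  congr 1
  exact cocycleHom_cyclesMap_yonedaPrecomp φ.hom n z
end

section
variable {R : Type u} [CommRing R] (I : Ideal R)
open Limits

section
variable {J : Type} [SmallCategory J] [IsFiltered J] {F : J ⥤ ModuleCat.{u} R} {c : Cocone F}

lemma exists_rep_of_isColimit (hc : IsColimit c) (x : c.pt) :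
    ∃ (j : J) (a : F.obj j), c.ι.app j a = x := by
  have : PreservesFilteredColimitsOfSize.{0, 0} (forget (ModuleCat.{u} R)) :=
    preservesFilteredColimitsOfSize_shrink.{0, u, 0, u} _
  exact Concrete.isColimit_exists_rep F hc x

lemma exists_map_eq_zero_of_isColimit (hc : IsColimit c) {j : J} (a : F.obj j)
    (ha : c.ι.app j a = 0) : ∃ (k : J) (f : j ⟶ k), F.map f a = 0 := by
  have : PreservesFilteredColimitsOfSize.{0, 0} (forget (ModuleCat.{u} R)) :=
    preservesFilteredColimitsOfSize_shrink.{0, u, 0, u} _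
  obtain ⟨k, f, g, h⟩ := Concrete.isColimit_exists_of_rep_eq F hc a (0 : F.obj j)
    (by simpa using ha)
  exact ⟨k, f, h.trans (map_zero (F.map g).hom)⟩
end

/-- The projection `R ⧸ I ^ t' ⟶ R ⧸ I ^ t`. -/
def quotPowMap {t t' : ℕ} (h : t ≤ t') :
    ModuleCat.of R (R ⧸ I ^ t') ⟶ ModuleCat.of R (R ⧸ I ^ t) :=
  ModuleCat.ofHom (Submodule.mapQ _ _ LinearMap.id (Ideal.pow_le_pow_right h))

/-- The structure map at `t` of the colimit defining local cohomology. -/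
noncomputable def localCohomologyι (i t : ℕ) (N : ModuleCat.{u} R) :
    ((Ext R (ModuleCat.{u} R) i).obj (.op (ModuleCat.of R (R ⧸ I ^ t)))).obj N ⟶
      (localCohomology I i).obj N :=
  (colimit.ι (localCohomology.diagram (localCohomology.idealPowersDiagram I) i)
    (.op (.op t))).app N

variable {I} {i : ℕ}

lemma localCohomologyι_naturality (t : ℕ) {N N' : ModuleCat.{u} R} (f : N ⟶ N') :
    localCohomologyι I i t N ≫ (localCohomology I i).map f =
     ((Ext R (ModuleCat.{u} R) i).obj (.op (ModuleCat.of R (R ⧸ I ^ t)))).map f ≫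
        localCohomologyι I i t N' :=
  ((colimit.ι (localCohomology.diagram (localCohomology.idealPowersDiagram I) i)
    (.op (.op t))).naturality f).symm

/-- The maps `localCohomologyι` form a colimit cocone. -/
noncomputable def localCohomologyIsColimit (N : ModuleCat.{u} R) :=
  isColimitOfPreserves ((evaluation (ModuleCat.{u} R) (ModuleCat.{u} R)).obj N)
    (colimit.isColimit (localCohomology.diagram (localCohomology.idealPowersDiagram I) i))

variable {N : ModuleCat.{u} R}

lemma exists_localCohomologyι_eq (x : (localCohomology I i).obj N) :
    ∃ (t : ℕ) (a : ((Ext R (ModuleCat.{u} R) i).obj (.op (ModuleCat.of R (R ⧸ I ^ t)))).obj N),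
      localCohomologyι I i t N a = x := by
  obtain ⟨j, a, h⟩ := exists_rep_of_isColimit (localCohomologyIsColimit (I := I) (i := i) N) x
  exact ⟨j.unop.unop, a, h⟩

lemma localCohomologyι_quotPowMap {t t' : ℕ} (h : t ≤ t') :
    ((Ext R (ModuleCat.{u} R) i).map (quotPowMap I h).op).app N ≫ localCohomologyι I i t' N =
      localCohomologyι I i t N :=
  congrArg (fun f => f.app N) (colimit.w
    (localCohomology.diagram (localCohomology.idealPowersDiagram I) i) (homOfLE h).op.op)

lemma localCohomologyι_eq_zero_iff (t : ℕ)
    (a : ((Ext R (ModuleCat.{u} R) i).obj (.op (ModuleCat.of R (R ⧸ I ^ t)))).obj N) :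
    localCohomologyι I i t N a = 0 ↔ ∃ (t' : ℕ) (h : t ≤ t'),
     ((Ext R (ModuleCat.{u} R) i).map (quotPowMap I h).op).app N a = 0 := by
  constructor
  · intro ha
    obtain ⟨k, f, h⟩ := exists_map_eq_zero_of_isColimit
      (localCohomologyIsColimit (I := I) (i := i) N) (j := .op (.op t)) a ha
    exact ⟨k.unop.unop, leOfHom f.unop.unop, h⟩
  · rintro ⟨t', h, h0⟩
    rw [← ConcreteCategory.congr_hom (localCohomologyι_quotPowMap h) a,
      ConcreteCategory.comp_apply, h0, map_zero]

lemma localCohomology_map_smul_id (r : R) : (localCohomology I i).map (r • 𝟙 N) = r • 𝟙 _ := by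
  ext x
  obtain ⟨t, a, rfl⟩ := exists_localCohomologyι_eq x
  have := ConcreteCategory.congr_hom
    (localCohomologyι_naturality (I := I) (i := i) t (r • 𝟙 N)) a
  refine this.trans ?_
  rw [Ext_map_smul_id, ConcreteCategory.comp_apply]
  exact map_smul (localCohomologyι I i t N).hom r a

/-- Every element of `Ext^i(R ⧸ I ^ t, N)` dies in `Ext^i(R ⧸ I ^ t', N)` for large `t'`. -/
def ExtPowVanishes (I : Ideal R) (i : ℕ) (N : ModuleCat.{u} R) : Prop :=
  ∀ (t : ℕ) (ξ : Abelian.Ext (ModuleCat.of R (R ⧸ I ^ t)) N i),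
    ∃ (t' : ℕ) (h : t ≤ t'), (Abelian.Ext.mk₀ (quotPowMap I h)).comp ξ (zero_add i) = 0

/-- In positive degrees, vanishing of local cohomology can be tested on `Abelian.Ext`. -/
lemma subsingleton_localCohomology_iff : Subsingleton ((localCohomology I (i+1)).obj N) ↔
    ExtPowVanishes I (i+1) N := by
  have H (t t' : ℕ) (h : t ≤ t') {a} {ξ : Abelian.Ext (ModuleCat.of R (R ⧸ I ^ t)) N (i+1)}
     (hr : ExtRel (projectiveResolution _) a ξ) :=
    (hr.precomp (projectiveResolution _) (quotPowMap I h)).eq_zero_iff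
  constructor
  · intro _ t ξ
    obtain ⟨a, ha⟩ := ExtRel.exists_left (projectiveResolution _) ξ
    obtain ⟨t', h, h0⟩ := (localCohomologyι_eq_zero_iff t a).1 (Subsingleton.elim _ _)
    exact ⟨t', h, (H _ _ h ha).1 h0⟩
  · intro hP
    refine subsingleton_of_forall_eq 0 fun x => ?_
    obtain ⟨t, a, rfl⟩ := exists_localCohomologyι_eq x
    obtain ⟨ξ, hξ⟩ := ExtRel.exists_right (projectiveResolution _) a
    obtain ⟨t', h, h0⟩ := hP t ξ
    exact (localCohomologyι_eq_zero_iff t a).2 ⟨t', h, (H _ _ h hξ).2 h0⟩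
end

end

section
open Abelian

section
variable {R : Type u} [CommRing R] {I : Ideal R} {i : ℕ}
open Pointwise

lemma quotPowMap_comp {t t' t'' : ℕ} (h : t ≤ t') (h' : t' ≤ t'') :
    quotPowMap I h' ≫ quotPowMap I h = quotPowMap I (h.trans h') := by
  refine ModuleCat.hom_ext (LinearMap.ext fun x ↦ ?_)
  obtain ⟨x, rfl⟩ := Submodule.mkQ_surjective _ x
  rfl

lemma mk₀_quotPowMap_comp_eq_zero_of_le {N : ModuleCat.{u} R} {t t' t'' : ℕ} (h : t ≤ t')
    (h' : t' ≤ t'') {ξ : Ext (ModuleCat.of R (R ⧸ I ^ t)) N i}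
    (h0 : (Ext.mk₀ (quotPowMap I h')).comp ((Ext.mk₀ (quotPowMap I h)).comp ξ (zero_add i))
      (zero_add i) = 0) :
    (Ext.mk₀ (quotPowMap I (h.trans h'))).comp ξ (zero_add i) = 0 := by
  rwa [Ext.mk₀_comp_mk₀_assoc, quotPowMap_comp] at h0

lemma mk₀_comp_comp_eq_zero {C : Type*} [Category* C] [Abelian C] [HasExt C] {W X Y Z : C}
    {f : W ⟶ X} {a b c : ℕ} {α : Ext X Y a} (h : (Ext.mk₀ f).comp α (zero_add a) = 0)
    (β : Ext Y Z b) (hc : a + b = c) : (Ext.mk₀ f).comp (α.comp β hc) (zero_add c) = 0 := by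
  rw [← Ext.comp_assoc _ _ _ (zero_add a) hc (by lia), h, Ext.zero_comp]

namespace ExtPowVanishes

lemma of_subsingleton (N : ModuleCat.{u} R) [Subsingleton N] : ExtPowVanishes I i N := by
  intro t ξ
  have h : 𝟙 N = 0 := by ext; exact Subsingleton.elim _ _
  refine ⟨t, le_rfl, ?_⟩
  rw [← ξ.comp_mk₀_id, h, Ext.mk₀_zero, Ext.comp_zero, Ext.comp_zero]

lemma of_isSMulRegular {A : ModuleCat.{u} R} {x : R} (hx : x ∈ I) (reg : IsSMulRegular A x)
    (h : ExtPowVanishes I i (ModuleCat.of R (QuotSMulTop x A))) : ExtPowVanishes I (i + 1) A := by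
  have key (k : ℕ) : ∀ (t : ℕ) (ξ : Ext (ModuleCat.of R (R ⧸ I ^ t)) A (i + 1)), x ^ k • ξ = 0 →
      ∃ (t' : ℕ) (h : t ≤ t'), (Ext.mk₀ (quotPowMap I h)).comp ξ (zero_add _) = 0 := by
    induction k with
    | zero => exact fun t ξ hξ ↦ ⟨t, le_rfl, by simp [show ξ = 0 by simpa using hξ]⟩
    | succ k ih =>
      intro t ξ hξ
      rw [pow_succ', mul_smul, Ext.smul_eq_comp_mk₀] at hξ
      obtain ⟨η, hη⟩ := Ext.covariant_sequence_exact₁ _ reg.smulShortComplex_shortExact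
        (x ^ k • ξ) hξ rfl
      obtain ⟨t', h', h0⟩ := h t η
      obtain ⟨t'', h'', h0'⟩ := ih t' ((Ext.mk₀ (quotPowMap I h')).comp ξ (zero_add _)) (by
        rw [← Ext.comp_smul, ← hη]
        exact mk₀_comp_comp_eq_zero h0 _ rfl)
      exact ⟨t'', h'.trans h'', mk₀_quotPowMap_comp_eq_zero_of_le h' h'' h0'⟩
  intro t ξ
  refine key t t ξ ?_
  have h0 : x ^ t • 𝟙 (ModuleCat.of R (R ⧸ I ^ t)) = 0 := by
    refine ModuleCat.hom_ext (LinearMap.ext fun y ↦ ?_)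
    obtain ⟨y, rfl⟩ := Submodule.mkQ_surjective _ y
    refine (Ideal.Quotient.eq_zero_iff_mem (I := I ^ t) (a := x ^ t * y)).2 ?_
    exact Ideal.mul_mem_right _ _ (Ideal.pow_mem_pow hx t)
  rw [← ξ.mk₀_id_comp, ← Ext.smul_comp, ← Ext.mk₀_smul, h0, Ext.mk₀_zero, Ext.zero_comp]

variable {S : ShortComplex (ModuleCat.{u} R)}

lemma middle (hS : S.ShortExact) (h₁ : ExtPowVanishes I i S.X₁) (h₃ : ExtPowVanishes I i S.X₃) :
    ExtPowVanishes I i S.X₂ := by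
  intro t ξ
  obtain ⟨t', h, h0⟩ := h₃ t (ξ.comp (Ext.mk₀ S.g) (add_zero i))
  rw [← Ext.comp_assoc_of_third_deg_zero] at h0
  obtain ⟨η, hη⟩ := Ext.covariant_sequence_exact₂ _ hS _ h0
  obtain ⟨t'', h', h0'⟩ := h₁ t' η
  refine ⟨t'', h.trans h', mk₀_quotPowMap_comp_eq_zero_of_le h h' ?_⟩
  rw [← hη]
  exact mk₀_comp_comp_eq_zero h0' _ _

lemma right (hS : S.ShortExact) (h₂ : ExtPowVanishes I i S.X₂)
    (h₁ : ExtPowVanishes I (i + 1) S.X₁) :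
    ExtPowVanishes I i S.X₃ := by
  intro t ξ
  obtain ⟨t', h, h0⟩ := h₁ t (ξ.comp hS.extClass rfl)
  rw [← Ext.comp_assoc _ _ _ (zero_add i) rfl (by lia)] at h0
  obtain ⟨η, hη⟩ := Ext.covariant_sequence_exact₃ _ hS _ rfl h0
  obtain ⟨t'', h', h0'⟩ := h₂ t' η
  refine ⟨t'', h.trans h', mk₀_quotPowMap_comp_eq_zero_of_le h h' ?_⟩
  rw [← hη]
  exact mk₀_comp_comp_eq_zero h0' _ _

end ExtPowVanishes
end

section
variable {R : Type u} [CommRing R] {I : Ideal R}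

section
variable {C : Type*} [Category* C] [Abelian C] [HasExt C]

/-- A class on the cokernel of `S` obtained from `η` by a connecting map is killed by a morphism
of short exact sequences whose first component factors through a morphism killing `η`. -/
lemma mk₀_comp_extClass_comp_eq_zero {S' S : ShortComplex C} (hS' : S'.ShortExact)
    (hS : S.ShortExact) (φ : S' ⟶ S) {W N : C} (l : S'.X₁ ⟶ W) (m : W ⟶ S.X₁)
    (hφ : l ≫ m = φ.τ₁) {j k : ℕ} (η : Ext S.X₁ N j)
    (hη : (Ext.mk₀ m).comp η (zero_add j) = 0) (hk : 1 + j = k) :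
    (Ext.mk₀ φ.τ₃).comp (hS.extClass.comp η hk) (zero_add k) = 0 := by
  rw [← Ext.comp_assoc _ _ _ (zero_add 1) hk (by lia), ← hS'.extClass_naturality hS φ,
    Ext.comp_assoc _ _ _ (add_zero 1) (zero_add j) (by lia), ← hφ, ← Ext.mk₀_comp_mk₀_assoc, hη,
    Ext.comp_zero, Ext.comp_zero]
end

/-- A commutative square of linear maps with surjective horizontal maps induces a morphism between
the short complexes of kernels. -/
noncomputable def shortComplexKerMap {A B A' B' : Type u} [AddCommGroup A] [Module R A]
    [AddCommGroup B] [Module R B] [AddCommGroup A'] [Module R A'] [AddCommGroup B'] [Module R B']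
    (f' : A' →ₗ[R] B') (f : A →ₗ[R] B) (a : A' →ₗ[R] A) (b : B' →ₗ[R] B)
    (h : f ∘ₗ a = b ∘ₗ f') :
    f'.shortComplexKer ⟶ f.shortComplexKer where
  τ₁ := ModuleCat.ofHom (a.restrict fun x hx ↦ by
    simpa [(LinearMap.mem_ker.1 hx)] using LinearMap.congr_fun h x)
  τ₂ := ModuleCat.ofHom a
  τ₃ := ModuleCat.ofHom b
  comm₁₂ := rfl
  comm₂₃ := by
    rw [← ModuleCat.ofHom_comp, ← ModuleCat.ofHom_comp, h]

/-- The inclusion of `I ^ t X` in `X`. -/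
def powSMulTopι (I : Ideal R) (t : ℕ) (X : Type u) [AddCommGroup X] [Module R X] :
    ModuleCat.of R ↥(I ^ t • (⊤ : Submodule R X)) ⟶ ModuleCat.of R X :=
  ModuleCat.ofHom (Submodule.subtype _)

lemma exists_powSMulTopι_comp_eq_zero [IsNoetherianRing R] {N : ModuleCat.{u} R}
    (hN : ∀ a ∈ I, ∀ n : N, a • n = 0) (j : ℕ) (X : Type u) [AddCommGroup X] [Module R X]
    [Module.Finite R X] (ξ : Ext (ModuleCat.of R X) N j) :
    ∃ t : ℕ, (Ext.mk₀ (powSMulTopι I t X)).comp ξ (zero_add j) = 0 := by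
  induction j generalizing X with
  | zero =>
    obtain ⟨f, rfl⟩ := Ext.homEquiv₀.symm.surjective ξ
    refine ⟨1, ?_⟩
    have h0 : powSMulTopι I 1 X ≫ f = 0 := by
      refine ModuleCat.hom_ext (LinearMap.ext fun x ↦ ?_)
      obtain ⟨x, hx⟩ := x
      change f.hom x = 0
      rw [pow_one] at hx
      refine Submodule.smul_induction_on hx (fun a ha y _ ↦ ?_) (fun y z hy hz ↦ ?_)
      · rw [map_smul, hN a ha]
      · rw [map_add, hy, hz, add_zero]
    rw [Ext.homEquiv₀_symm_apply, Ext.mk₀_comp_mk₀, h0, Ext.mk₀_zero]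
  | succ j ih =>
    obtain ⟨n, f, hf⟩ := Module.Finite.exists_fin' R X
    have hS := LinearMap.shortExact_shortComplexKer hf
    have : Projective (ModuleCat.of R (Fin n → R)) :=
      (IsProjective.iff_projective _).1 inferInstance
    obtain ⟨η, rfl⟩ := Ext.contravariant_sequence_exact₃ hS N ξ (Ext.eq_zero_of_projective _)
      (add_comm 1 j)
    obtain ⟨t, ht⟩ := ih _ η
    obtain ⟨k, hk⟩ := I.exists_pow_inf_eq_pow_smul (LinearMap.ker f)
    refine ⟨t + k, ?_⟩
    let P := I ^ (t + k) • (⊤ : Submodule R (Fin n → R))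
    let Q := I ^ (t + k) • (⊤ : Submodule R X)
    have hPQ : P.map f = Q := by
      rw [Submodule.map_smul'', Submodule.map_top, LinearMap.range_eq_top.2 hf]
    have hm : ∀ x ∈ P, f x ∈ Q := fun x hx ↦ hPQ ▸ Submodule.mem_map_of_mem hx
    have hf' : Function.Surjective (f.restrict hm) := by
      rintro ⟨y, hy⟩
      rw [← hPQ] at hy
      obtain ⟨x, hx, rfl⟩ := hy
      exact ⟨⟨x, hx⟩, rfl⟩
    let φ := shortComplexKerMap (f.restrict hm) f P.subtype Q.subtype rfl
    have hφ (y) : φ.τ₁.hom y ∈ I ^ t • (⊤ : Submodule R (LinearMap.ker f)) := by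
      have hy : (φ.τ₁.hom y).1 ∈ P ⊓ LinearMap.ker f := ⟨y.1.2, (φ.τ₁.hom y).2⟩
      rw [hk _ (by lia), Nat.add_sub_cancel] at hy
      exact (Submodule.mem_smul_top_iff _ _ _).2 (Submodule.smul_mono le_rfl inf_le_right hy)
    exact mk₀_comp_extClass_comp_eq_zero (LinearMap.shortExact_shortComplexKer hf') hS φ
      (ModuleCat.ofHom (φ.τ₁.hom.codRestrict _ hφ)) (powSMulTopι I t _) rfl η ht _

namespace ExtPowVanishes

lemma of_smul_eq_zero [IsNoetherianRing R] {N : ModuleCat.{u} R}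
    (hN : ∀ a ∈ I, ∀ n : N, a • n = 0) (j : ℕ) : ExtPowVanishes I (j + 1) N := by
  intro t ξ
  have hS (s : ℕ) := LinearMap.shortExact_shortComplexKer (I ^ s).mkQ_surjective
  have : Projective (ModuleCat.of R R) := (IsProjective.iff_projective _).1 inferInstance
  obtain ⟨η, rfl⟩ := Ext.contravariant_sequence_exact₃ (hS t) N ξ (Ext.eq_zero_of_projective _)
      (add_comm 1 j)
  obtain ⟨s, hs⟩ := exists_powSMulTopι_comp_eq_zero hN _ _ η
  refine ⟨s + t, by lia, ?_⟩
  let φ := shortComplexKerMap (I ^ (s + t)).mkQ (I ^ t).mkQ LinearMap.id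
    (Submodule.mapQ _ _ LinearMap.id (Ideal.pow_le_pow_right (by lia))) rfl
  have hφ (y) : φ.τ₁.hom y ∈ I ^ s • (⊤ : Submodule R (LinearMap.ker (I ^ t).mkQ)) := by
    have h : LinearMap.ker (I ^ (s + t)).mkQ ≤ I ^ s • LinearMap.ker (I ^ t).mkQ := by
      rw [Submodule.ker_mkQ, Submodule.ker_mkQ, smul_eq_mul, pow_add]
    exact (Submodule.mem_smul_top_iff _ _ _).2 (h y.2)
  exact mk₀_comp_extClass_comp_eq_zero (hS (s + t)) (hS t) φ
      (ModuleCat.ofHom (φ.τ₁.hom.codRestrict _ hφ)) (powSMulTopι I s _) rfl η hs _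

end ExtPowVanishes
end

section
variable {R : Type u} [CommRing R] {I : Ideal R} {i : ℕ}

namespace ExtPowVanishes

lemma of_exact {A B C : Type u} [AddCommGroup A] [Module R A] [AddCommGroup B] [Module R B]
    [AddCommGroup C] [Module R C] (f : A →ₗ[R] B) (g : B →ₗ[R] C) (hf : Function.Injective f)
    (hg : Function.Surjective g) (hfg : Function.Exact f g)
    (hA : ExtPowVanishes I i (ModuleCat.of R A)) (hC : ExtPowVanishes I i (ModuleCat.of R C)) :
    ExtPowVanishes I i (ModuleCat.of R B) :=
  middle (ModuleCat.shortComplex_shortExact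
    (ModuleCat.shortComplexOfCompEqZero f g hfg.linearMap_comp_eq_zero) hfg hf hg) hA hC

lemma pi_fin (h : ExtPowVanishes I i (ModuleCat.of R R)) (n : ℕ) :
    ExtPowVanishes I i (ModuleCat.of R (Fin n → R)) := by
  induction n with
  | zero => exact of_subsingleton _
  | succ n ih =>
    refine of_exact (LinearMap.single R (fun _ : Fin (n + 1) ↦ R) 0)
      (LinearMap.funLeft R R Fin.succ) (Pi.single_injective (M := fun _ : Fin (n + 1) ↦ R) 0)
      (LinearMap.funLeft_surjective_of_injective _ _ _ (Fin.succ_injective n)) ?_ h ih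
    intro x
    constructor
    · intro hx
      refine ⟨x 0, funext fun j ↦ ?_⟩
      cases j using Fin.cases with
      | zero => simp
      | succ j => simpa using (congrFun hx j).symm
    · rintro ⟨y, rfl⟩
      ext j
      simp [LinearMap.funLeft_apply]

/-- The local cohomology of `N` vanishes above the dimension of its support. -/
lemma of_supportDim_lt [IsNoetherianRing R] (d : ℕ) (N : Type u) [AddCommGroup N] [Module R N]
    [hN : Module.Finite R N] (hd : Module.supportDim R N < d) (i : ℕ) (hi : d ≤ i) :
    ExtPowVanishes I i (ModuleCat.of R N) := by
  induction d generalizing N i with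
  | zero =>
    have : Subsingleton N := by
      by_contra h
      rw [not_subsingleton_iff_nontrivial] at h
      exact Module.supportDim_ne_bot_of_nontrivial R N
        ((ENat.WithBot.add_one_le_zero_iff _).1 (ENat.WithBot.add_one_le_natCast_iff.2 hd))
    exact of_subsingleton (ModuleCat.of R N)
  | succ d ih =>
    obtain ⟨i, rfl⟩ : ∃ j, i = j + 1 := ⟨i - 1, by lia⟩
    induction hN using IsNoetherianRing.induction_on_isQuotientEquivQuotientPrime R with
    | subsingleton N => exact of_subsingleton (ModuleCat.of R N)
    | quotient N p e =>
      by_cases hp : I ≤ p.asIdeal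
      · refine of_smul_eq_zero (fun a ha (n : N) ↦ e.injective ?_) i
        obtain ⟨y, hy⟩ := Submodule.mkQ_surjective _ (e n)
        rw [map_smul, map_zero, ← hy, ← map_smul]
        exact (Submodule.Quotient.mk_eq_zero _).2 (p.asIdeal.mul_mem_right _ (hp ha))
      · obtain ⟨x, hx, hxp⟩ := Set.not_subset.1 hp
        have reg : IsSMulRegular N x := by
          refine (isSMulRegular_iff_right_eq_zero_of_smul).2 fun n hn ↦ e.injective ?_
          obtain ⟨y, hy⟩ := Submodule.mkQ_surjective _ (e n)
          have := congrArg e hn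
          rw [map_smul, map_zero, ← hy, ← map_smul] at this
          rw [map_zero, ← hy]
          refine (Submodule.Quotient.mk_eq_zero _).2 ?_
          exact (p.isPrime.mem_or_mem ((Submodule.Quotient.mk_eq_zero _).1 this)).resolve_left hxp
        have hle := Module.supportDim_quotSMulTop_succ_le_of_notMem_minimalPrimes
          fun q hq ↦ reg.notMem_of_mem_minimalPrimes hq
        refine of_isSMulRegular (A := ModuleCat.of R N) hx reg (ih _ ?_ _ (by lia))
        exact ENat.WithBot.add_one_le_natCast_iff.1
          (hle.trans (ENat.WithBot.lt_add_one_iff.1 (by exact_mod_cast hd)))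
    | exact N₁ N₂ N₃ f g hf hg hfg h₁ h₃ =>
      exact of_exact f g hf hg hfg (h₁ ((Module.supportDim_le_of_injective f hf).trans_lt hd))
        (h₃ ((Module.supportDim_le_of_surjective g hg).trans_lt hd))

/-- Vanishing above degree `c` passes from the ring to all finitely generated modules. -/
lemma of_ring [IsNoetherianRing R] [FiniteRingKrullDim R] {c : ℕ}
    (h : ∀ i, c < i → ExtPowVanishes I i (ModuleCat.of R R)) {i : ℕ} (hi : c < i)
    (N : Type u) [AddCommGroup N] [Module R N] [Module.Finite R N] :
    ExtPowVanishes I i (ModuleCat.of R N) := by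
  obtain ⟨d, hd⟩ : ∃ d : ℕ, ringKrullDim R < d := by
    by_contra! h
    exact ringKrullDim_ne_top (ENat.WithBot.eq_top_iff_forall_ge.2 h)
  have key (k : ℕ) : ∀ (i : ℕ) (_ : c < i) (_ : d ≤ i + k) (N : Type u) [AddCommGroup N]
      [Module R N] [Module.Finite R N], ExtPowVanishes I i (ModuleCat.of R N) := by
    induction k with
    | zero =>
      intro i _ hi N _ _ _
      exact of_supportDim_lt d N ((Module.supportDim_le_ringKrullDim R N).trans_lt hd) i hi
    | succ k ih =>
      intro i hi hk N _ _ _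
      obtain ⟨n, f, hf⟩ := Module.Finite.exists_fin' R N
      exact right (LinearMap.shortExact_shortComplexKer hf) (pi_fin (h i hi) n)
        (ih (i + 1) (by lia) (by lia) _)
  exact key d i hi (by lia) N

end ExtPowVanishes

/-- A nonzero finitely generated torsion-free module over a domain has a nonzero functional. -/
lemma exists_dual_apply_ne_zero [IsDomain R] [IsNoetherianRing R] (M : Type u) [AddCommGroup M]
    [Module R M] [Module.Finite R M] [NoZeroSMulDivisors R M] [Nontrivial M] :
    ∃ (f : M →ₗ[R] R) (m : M), f m ≠ 0 := by
  obtain ⟨m, hm⟩ := exists_ne (0 : M)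
  let S := nonZeroDivisors R
  let K := FractionRing R
  let l := LocalizedModule.mkLinearMap S M
  have hlm : l m ≠ 0 := by
    intro h
    obtain ⟨s, hs⟩ := (IsLocalizedModule.eq_zero_iff S l).1 h
    exact (smul_ne_zero (nonZeroDivisors.coe_ne_zero s) hm) hs
  obtain ⟨φ, hφ⟩ : ∃ φ : Module.Dual K (LocalizedModule S M), φ (l m) ≠ 0 := by
    by_contra! h
    exact hlm ((Module.forall_dual_apply_eq_zero_iff K _).1 h)
  have := Module.finitePresentation_of_finite R M
  obtain ⟨f, s, hf⟩ := Module.FinitePresentation.exists_lift_of_isLocalizedModule S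
    (Algebra.linearMap R K) (φ.restrictScalars R ∘ₗ l)
  refine ⟨f, m, fun h0 ↦ ?_⟩
  have h1 : (0 : K) = s • φ (l m) := by simpa [h0] using LinearMap.congr_fun hf m
  rw [Submonoid.smul_def, Algebra.smul_def] at h1
  exact mul_ne_zero (IsLocalization.to_map_ne_zero_of_mem_nonZeroDivisors K le_rfl s.2) hφ h1.symm
end

end

section
variable {R : Type u} [CommRing R]

/-- Over a domain, a module has full support as soon as its support contains the generic point. -/
lemma support_eq_univ_iff_exists [IsDomain R] (N : Type*) [AddCommGroup N] [Module R N] :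
    Module.support R N = Set.univ ↔ ∃ n : N, ∀ r : R, r • n = 0 → r = 0 := by
  constructor
  · intro h
    obtain ⟨n, hn⟩ := Module.mem_support_iff_exists_annihilator.1
      (h.ge (Set.mem_univ (⟨⊥, Ideal.isPrime_bot⟩ : PrimeSpectrum R)))
    exact ⟨n, fun r hr ↦ by
      simpa using hn ((Submodule.mem_annihilator_span_singleton _ _).2 hr)⟩
  · rintro ⟨n, hn⟩
    refine Set.eq_univ_of_forall fun p ↦ Module.mem_support_iff_exists_annihilator.2 ⟨n, ?_⟩
    intro r hr
    rw [hn r ((Submodule.mem_annihilator_span_singleton _ _).1 hr)]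
    exact zero_mem _

/-- Full support of the dual of a local cohomology module of the ring passes to torsion-free
modules in the same cohomological degree. -/
lemma support_dual_localCohomology_eq_univ [IsDomain R] [IsNoetherianRing R] (E : Type u)
    [AddCommGroup E] [Module R E] (I : Ideal R) (c : ℕ)
    (hfull : Module.support R ((localCohomology I c).obj (ModuleCat.of R R) →ₗ[R] E) = Set.univ)
    (M : ModuleCat.{u} R) [Module.Finite R M] [NoZeroSMulDivisors R M] [Nontrivial M] :
    Module.support R ((localCohomology I c).obj M →ₗ[R] E) = Set.univ := by
  rw [support_eq_univ_iff_exists] at hfull ⊢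
  obtain ⟨ψ, hψ⟩ := hfull
  obtain ⟨f, m, hfm⟩ := exists_dual_apply_ne_zero (R := R) M
  let F : M ⟶ ModuleCat.of R R := ModuleCat.ofHom f
  let G : ModuleCat.of R R ⟶ M := ModuleCat.ofHom (LinearMap.toSpanSingleton R M m)
  have hGF : G ≫ F = f m • 𝟙 _ := by
    ext
    simp [G, F]
  have hLC : (localCohomology I c).map G ≫ (localCohomology I c).map F = f m • 𝟙 _ := by
    rw [← Functor.map_comp, hGF, localCohomology_map_smul_id]
  refine ⟨ψ ∘ₗ ((localCohomology I c).map F).hom, fun r hr ↦ ?_⟩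
  refine (mul_eq_zero.1 (hψ (r * f m) (LinearMap.ext fun x ↦ ?_))).resolve_right hfm
  have h1 := ConcreteCategory.congr_hom hLC x
  have h2 := LinearMap.congr_fun hr ((localCohomology I c).map G x)
  have h3 : ψ (f m • x) = ψ ((localCohomology I c).map F ((localCohomology I c).map G x)) :=
    congrArg ψ h1.symm
  rw [mul_smul, LinearMap.smul_apply, LinearMap.smul_apply, ← map_smul, h3]
  exact h2

/-- The cohomological dimension of the ring bounds that of finitely generated modules. -/
lemma subsingleton_localCohomology_of_ring [IsNoetherianRing R] [FiniteRingKrullDim R] (I : Ideal R)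
    {c : ℕ} (h : ∀ i, c < i → Subsingleton ((localCohomology I i).obj (ModuleCat.of R R)))
    {i : ℕ} (hi : c < i) (M : ModuleCat.{u} R) [Module.Finite R M] :
    Subsingleton ((localCohomology I i).obj M) := by
  obtain ⟨i, rfl⟩ : ∃ j, i = j + 1 := ⟨i - 1, by lia⟩
  refine subsingleton_localCohomology_iff.2 (ExtPowVanishes.of_ring (fun k hk ↦ ?_) hi M)
  obtain ⟨k, rfl⟩ : ∃ j, k = j + 1 := ⟨k - 1, by lia⟩
  exact subsingleton_localCohomology_iff.1 (h _ hk)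

end

/-- If the Matlis dual of the top local cohomology of a Noetherian local domain `R` has
full support, then the same holds for any finitely generated torsion-free module `M`. -/
theorem support_matlisDual_top_localCohomology_of_torsionFree
    (R : Type u) [CommRing R] [IsDomain R] [IsLocalRing R] [IsNoetherianRing R]
    (E : Type u) [AddCommGroup E] [Module R E]
    (hE : IsInjectiveHullOfResidueField R E)
    (I : Ideal R) (c : ℕ)
    (hcR_ne : Nontrivial ((localCohomology I c).obj (ModuleCat.of R R)))
    (hcR_top : ∀ i : ℕ, c < i →
      Subsingleton ((localCohomology I i).obj (ModuleCat.of R R)))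
    (hfull : Module.support R
      (((localCohomology I c).obj (ModuleCat.of R R)) →ₗ[R] E) = Set.univ)
    (M : ModuleCat.{u} R) [Module.Finite R M] [NoZeroSMulDivisors R M]
    (c' : ℕ)
    (hcM_ne : Nontrivial ((localCohomology I c').obj M))
    (hcM_top : ∀ i : ℕ, c' < i → Subsingleton ((localCohomology I i).obj M)) :
    Module.support R (((localCohomology I c').obj M) →ₗ[R] E) = Set.univ := by
  have hM : Nontrivial M := by
    by_contra h
    rw [not_nontrivial_iff_subsingleton] at h
    have h0 : (0 : R) • 𝟙 M = 𝟙 M := by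
      ext
      exact Subsingleton.elim _ _
    obtain ⟨x, hx⟩ := exists_ne (0 : (localCohomology I c').obj M)
    have h1 : 𝟙 ((localCohomology I c').obj M) = 0 := by
      rw [← CategoryTheory.Functor.map_id, ← h0, localCohomology_map_smul_id, zero_smul]
    exact hx (ConcreteCategory.congr_hom h1 x)
  have hsupp := support_dual_localCohomology_eq_univ E I c hfull M
  suffices c' = c by rwa [this]
  refine le_antisymm (not_lt.1 fun h ↦ ?_) (not_lt.1 fun h ↦ ?_)
  · exact not_subsingleton _ (subsingleton_localCohomology_of_ring I hcR_top h M)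
  · have := hcM_top c h
    obtain ⟨φ, hφ⟩ := (support_eq_univ_iff_exists _).1 hsupp
    refine one_ne_zero (hφ 1 (LinearMap.ext fun x ↦ ?_))
    rw [Subsingleton.elim x 0, map_zero, map_zero]
end
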